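/- arXiv:2210.12962 — 15 statements merged into one kernel-verified Lean document; each statement's English description precedes it below -/
import Mathlib

section
/- For all real numbers X > 0 and Y > 0, one has P₁(X,Y) = 0 and Q₁(X,Y) = 0 if and only if X = 1/5 and Y = 1/5. (In other words, (1/5, 1/5) is the unique critical point in the open positive quadrant of the ε = 1 rescaled Laplacian coflow system.) -/
/-- Right-hand side `P_ε(X,Y)` of the rescaled Laplacian coflow equation for `X`. -/
noncomputable def coflowP (ε X Y : ℝ) : ℝ :=
  (4 / X ^ 2) *
    ((X + 1) * Y ^ 2 + 2 * ε * (2 * X ^ 2 - 2 * X - 1) * X * Y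
      - 2 * X ^ 2 * (2 * X - 1) * (X + 1))

/-- Right-hand side `Q_ε(X,Y)` of the rescaled Laplacian coflow equation for `Y`. -/
noncomputable def coflowQ (ε X Y : ℝ) : ℝ :=
  (4 * Y / X ^ 2) *
    (2 * (1 - X) * Y ^ 2 + ε * (2 * X ^ 2 - 3 * X - 1) * Y + 2 * X * (1 - 2 * X))

theorem coflow_critical_point_eps_pos (X Y : ℝ) (hX : 0 < X) (hY : 0 < Y) :
    (coflowP 1 X Y = 0 ∧ coflowQ 1 X Y = 0) ↔ (X = 1 / 5 ∧ Y = 1 / 5) := by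
  constructor
  · rintro ⟨hP, hQ⟩
    have hP' : (X + 1) * Y ^ 2 + 2 * (2 * X ^ 2 - 2 * X - 1) * X * Y
        - 2 * X ^ 2 * (2 * X - 1) * (X + 1) = 0 := by
      have h := (mul_eq_zero.mp hP).resolve_left (by positivity)
      linear_combination h
    have hQ' : 2 * (1 - X) * Y ^ 2 + (2 * X ^ 2 - 3 * X - 1) * Y
        + 2 * X * (1 - 2 * X) = 0 := by
      have h := (mul_eq_zero.mp hQ).resolve_left (by positivity)
      linear_combination h
    have hC : 0 < 2 * X ^ 2 - 2 * X + 1 := by nlinarith [sq_nonneg (2 * X - 1)]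
    -- Eliminating the constant term in `Y` leaves an equation linear in `Y`.
    have hL : (X + 1) * (2 * X ^ 2 - 2 * X + 1) * Y
        - X * (2 * X - 1) * (X ^ 2 - 2 * X - 1) = 0 := by
      apply mul_left_cancel₀ hY.ne'
      linear_combination hP' - X * (X + 1) * hQ'
    have hpos : 0 < (X + 1) * (2 * X ^ 2 - 2 * X + 1) * Y := by positivity
    have hA : 2 * X - 1 ≠ 0 := by
      intro h
      rw [h] at hL
      linarith
    have hX1 : X - 1 ≠ 0 := by
      intro h
      obtain rfl : X = 1 := by linarith
      linarith
    have hR : X ^ 2 * (2 * X - 1) * (X - 1) * (6 * X ^ 3 + X ^ 2 + 1) * (5 * X - 1) = 0 := by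
      linear_combination -((X + 1) * (2 * X ^ 2 - 2 * X + 1) ^ 2) * hP'
        + ((X + 1) * (2 * X ^ 2 - 2 * X + 1) * Y + X * (2 * X - 1) * (X ^ 2 - 2 * X - 1)
          + 2 * (2 * X ^ 2 - 2 * X - 1) * X * (2 * X ^ 2 - 2 * X + 1)) * hL
    have hcubic : 6 * X ^ 3 + X ^ 2 + 1 ≠ 0 := by positivity
    have h5 : 5 * X - 1 = 0 :=
      (mul_eq_zero.mp hR).resolve_left
        (mul_ne_zero (mul_ne_zero (mul_ne_zero (by positivity) hA) hX1) hcubic)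
    obtain rfl : X = 1 / 5 := by linarith
    exact ⟨rfl, by linarith⟩
  · rintro ⟨rfl, rfl⟩
    constructor <;> norm_num [coflowP, coflowQ]
end

section
/- For all real numbers X > 0 and Y > 0, one has P₋₁(X,Y) = 0 and Q₋₁(X,Y) = 0 if and only if X = 1 and Y = 1. (In other words, (1, 1) is the unique critical point in the open positive quadrant of the ε = −1 rescaled Laplacian coflow system.) -/
theorem coflow_critical_point_eps_neg (X Y : ℝ) (hX : 0 < X) (hY : 0 < Y) :
    (coflowP (-1) X Y = 0 ∧ coflowQ (-1) X Y = 0) ↔ (X = 1 ∧ Y = 1) := by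
  constructor
  · rintro ⟨hP, hQ⟩
    have p : (X + 1) * Y ^ 2 + 2 * (-1) * (2 * X ^ 2 - 2 * X - 1) * X * Y
        - 2 * X ^ 2 * (2 * X - 1) * (X + 1) = 0 :=
      (mul_eq_zero.mp hP).resolve_left (by positivity)
    have q : 2 * (1 - X) * Y ^ 2 + (-1) * (2 * X ^ 2 - 3 * X - 1) * Y
        + 2 * X * (1 - 2 * X) = 0 :=
      (mul_eq_zero.mp hQ).resolve_left (by positivity)
    -- Eliminating the constant term in `Y` determines `Y` as a rational function of `X`.
    have hY_eq : Y * ((X + 1) * (2 * X ^ 2 - 2 * X + 1))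
        = X * (2 * X - 1) * (1 + 2 * X - X ^ 2) := by
      apply mul_left_cancel₀ hY.ne'
      linear_combination p - X * (X + 1) * q
    have hc : 0 < 2 * X ^ 2 - 2 * X + 1 := by nlinarith [sq_nonneg (2 * X - 1)]
    have half_lt : 1 / 2 < X := by
      by_contra! h
      have hpos : 0 < Y * ((X + 1) * (2 * X ^ 2 - 2 * X + 1)) := by positivity
      have hm : 0 ≤ 1 + 2 * X - X ^ 2 := by nlinarith
      have hneg : 0 ≤ X * (1 - 2 * X) * (1 + 2 * X - X ^ 2) :=
        mul_nonneg (mul_nonneg hX.le (by linarith)) hm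
      linarith
    have hquartic : 0 < 30 * X ^ 4 - X ^ 3 - X ^ 2 + 5 * X - 1 := by
      have h3 : 0 < X ^ 3 * (2 * X - 1) := mul_pos (by positivity) (by linarith)
      have h2 : 0 < X ^ 2 * (4 * X ^ 2 - 1) := mul_pos (by positivity) (by nlinarith)
      have h4 : 0 < X ^ 4 := by positivity
      linarith
    have hres : (X * (2 * X - 1) * (30 * X ^ 4 - X ^ 3 - X ^ 2 + 5 * X - 1)) * (X - 1) = 0 := by
      linear_combination
        (-((X + 1) * (2 * X ^ 2 - 2 * X + 1)) ^ 2) * q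
        + (2 * (1 - X) * (Y * ((X + 1) * (2 * X ^ 2 - 2 * X + 1))
            + X * (2 * X - 1) * (1 + 2 * X - X ^ 2))
          - (2 * X ^ 2 - 3 * X - 1) * ((X + 1) * (2 * X ^ 2 - 2 * X + 1))) * hY_eq
    have hfactor : X * (2 * X - 1) * (30 * X ^ 4 - X ^ 3 - X ^ 2 + 5 * X - 1) ≠ 0 :=
      (mul_pos (mul_pos hX (by linarith)) hquartic).ne'
    have hX1 : X = 1 := sub_eq_zero.mp ((mul_eq_zero.mp hres).resolve_left hfactor)
    subst hX1
    exact ⟨rfl, by linarith⟩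
  · rintro ⟨rfl, rfl⟩
    norm_num [coflowP, coflowQ]
end

section
/- For a real number X > 0, one has P₋₁(X,X) = Q₋₁(X,X) if and only if X = 1. In particular, the diagonal {X = Y} is not preserved by the ε = −1 rescaled Laplacian coflow system except at the critical point (1, 1). -/
/-- On the diagonal, `P₋₁ - Q₋₁` factors as `-8 (2X + 1) (X - 1)`. -/
theorem coflowP_sub_coflowQ_diagonal_neg {X : ℝ} (hX : X ≠ 0) :
    coflowP (-1) X X - coflowQ (-1) X X = -8 * (2 * X + 1) * (X - 1) := by
  unfold coflowP coflowQ
  field_simp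
  ring

theorem coflow_diagonal_eps_neg (X : ℝ) (hX : 0 < X) :
    coflowP (-1) X X = coflowQ (-1) X X ↔ X = 1 := by
  have h : -8 * (2 * X + 1) ≠ 0 := by
    have : 0 < 2 * X + 1 := by positivity
    exact mul_ne_zero (by norm_num) this.ne'
  rw [← sub_eq_zero, coflowP_sub_coflowQ_diagonal_neg hX.ne', mul_eq_zero, or_iff_right h,
    sub_eq_zero]
end

section
/- The Fréchet derivative at the point (1/5, 1/5) of the map (X,Y) ↦ (P₁(X,Y), Q₁(X,Y)), defined on the open set {(X,Y) ∈ ℝ² : X > 0}, is the linear endomorphism of ℝ² given in the standard basis by the matrix [[−76/5, −24/5], [−12/5, −88/5]], and its eigenvalues are exactly −64/5 and −20; in particular both eigenvalues are negative, so (1/5, 1/5) is a linearly stable critical point of the ε = 1 rescaled Laplacian coflow system. -/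
/-- The endomorphism of `ℝ²` with matrix `[[a, b], [c, d]]` in the standard basis. -/
noncomputable def planarCLM (a b c d : ℝ) : ℝ × ℝ →L[ℝ] ℝ × ℝ :=
  (a • ContinuousLinearMap.fst ℝ ℝ ℝ + b • ContinuousLinearMap.snd ℝ ℝ ℝ).prod
    (c • ContinuousLinearMap.fst ℝ ℝ ℝ + d • ContinuousLinearMap.snd ℝ ℝ ℝ)

theorem planarCLM_apply (a b c d : ℝ) (v : ℝ × ℝ) :
    planarCLM a b c d v = (a * v.1 + b * v.2, c * v.1 + d * v.2) := by
  simp [planarCLM]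

theorem hasFDerivAt_coflowP :
    HasFDerivAt (fun p : ℝ × ℝ => coflowP 1 p.1 p.2)
      (-(76 / 5 : ℝ) • ContinuousLinearMap.fst ℝ ℝ ℝ
        + -(24 / 5 : ℝ) • ContinuousLinearMap.snd ℝ ℝ ℝ) (1 / 5, 1 / 5) := by
  have hX : HasFDerivAt (fun p : ℝ × ℝ => p.1) (ContinuousLinearMap.fst ℝ ℝ ℝ)
      (1 / 5, 1 / 5) := hasFDerivAt_fst
  have hY : HasFDerivAt (fun p : ℝ × ℝ => p.2) (ContinuousLinearMap.snd ℝ ℝ ℝ)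
      (1 / 5, 1 / 5) := hasFDerivAt_snd
  have hI := (hasDerivAt_inv (x := ((1 / 5 : ℝ)) ^ 2) (by norm_num)).comp_hasFDerivAt
    ((1 / 5, 1 / 5) : ℝ × ℝ) (hX.pow 2)
  have h := (hI.const_mul 4).mul
    ((((hX.add_const 1).mul (hY.pow 2)).add
      (((((((hX.pow 2).const_mul 2).sub (hX.const_mul 2)).sub_const 1).const_mul (2 * 1)).mul
        hX).mul hY)).sub
      ((((hX.pow 2).const_mul 2).mul ((hX.const_mul 2).sub_const 1)).mul (hX.add_const 1)))
  refine (h.congr_fderiv ?_).congr_of_eventuallyEq (.of_forall fun p => ?_)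
  · ext <;> simp <;> norm_num
  · simp [coflowP, div_eq_mul_inv]

theorem hasFDerivAt_coflowQ :
    HasFDerivAt (fun p : ℝ × ℝ => coflowQ 1 p.1 p.2)
      (-(12 / 5 : ℝ) • ContinuousLinearMap.fst ℝ ℝ ℝ
        + -(88 / 5 : ℝ) • ContinuousLinearMap.snd ℝ ℝ ℝ) (1 / 5, 1 / 5) := by
  have hX : HasFDerivAt (fun p : ℝ × ℝ => p.1) (ContinuousLinearMap.fst ℝ ℝ ℝ)
      (1 / 5, 1 / 5) := hasFDerivAt_fst
  have hY : HasFDerivAt (fun p : ℝ × ℝ => p.2) (ContinuousLinearMap.snd ℝ ℝ ℝ)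
      (1 / 5, 1 / 5) := hasFDerivAt_snd
  have hI := (hasDerivAt_inv (x := ((1 / 5 : ℝ)) ^ 2) (by norm_num)).comp_hasFDerivAt
    ((1 / 5, 1 / 5) : ℝ × ℝ) (hX.pow 2)
  have h := ((hY.const_mul 4).mul hI).mul
    (((((hX.const_sub 1).const_mul 2).mul (hY.pow 2)).add
      ((((((hX.pow 2).const_mul 2).sub (hX.const_mul 3)).sub_const 1).const_mul 1).mul hY)).add
      ((hX.const_mul 2).mul ((hX.const_mul 2).const_sub 1)))
  refine (h.congr_fderiv ?_).congr_of_eventuallyEq (.of_forall fun p => ?_)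
  · ext <;> simp <;> norm_num
  · simp [coflowQ, div_eq_mul_inv]

theorem fderiv_coflow :
    fderiv ℝ (fun p : ℝ × ℝ => (coflowP 1 p.1 p.2, coflowQ 1 p.1 p.2)) (1 / 5, 1 / 5)
      = planarCLM (-(76 / 5)) (-(24 / 5)) (-(12 / 5)) (-(88 / 5)) :=
  (hasFDerivAt_coflowP.prodMk hasFDerivAt_coflowQ).fderiv

/-- The eigenvalues of a planar endomorphism with `c ≠ 0` are the roots of its characteristic
polynomial. -/
theorem hasEigenvalue_planarCLM_iff {a b c d : ℝ} (hc : c ≠ 0) (μ : ℝ) :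
    Module.End.HasEigenvalue (planarCLM a b c d).toLinearMap μ
      ↔ (μ - a) * (μ - d) - b * c = 0 := by
  constructor
  · intro h
    obtain ⟨⟨x, y⟩, hv⟩ := h.exists_hasEigenvector
    have hne := hv.2
    have happ := hv.apply_eq_smul
    simp only [ContinuousLinearMap.coe_coe, planarCLM_apply, Prod.smul_mk, smul_eq_mul,
      Prod.mk.injEq] at happ
    obtain ⟨h1, h2⟩ := happ
    have hy : y ≠ 0 := by
      rintro rfl
      have hx : x = 0 := by simpa [hc] using h2
      exact hne (by simp [hx])
    apply mul_right_cancel₀ hy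
    linear_combination -c * h1 - (μ - a) * h2
  · intro h
    refine Module.End.hasEigenvalue_of_hasEigenvector (x := (μ - d, c)) ⟨?_, ?_⟩
    · rw [Module.End.mem_eigenspace_iff]
      simp only [ContinuousLinearMap.coe_coe, planarCLM_apply, Prod.smul_mk, smul_eq_mul,
        Prod.mk.injEq]
      exact ⟨by linear_combination -h, by ring⟩
    · simp [hc]

theorem coflow_linearization_eps_pos :
    (∀ v : ℝ × ℝ,
        fderiv ℝ (fun p : ℝ × ℝ => (coflowP 1 p.1 p.2, coflowQ 1 p.1 p.2))
          (1 / 5, 1 / 5) v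
          = (-(76 / 5) * v.1 + -(24 / 5) * v.2, -(12 / 5) * v.1 + -(88 / 5) * v.2)) ∧
    (∀ μ : ℝ,
        Module.End.HasEigenvalue
          ((fderiv ℝ (fun p : ℝ × ℝ => (coflowP 1 p.1 p.2, coflowQ 1 p.1 p.2))
              (1 / 5, 1 / 5)).toLinearMap) μ
          ↔ μ = -(64 / 5) ∨ μ = -20) := by
  rw [fderiv_coflow]
  refine ⟨planarCLM_apply _ _ _ _, fun μ => ?_⟩
  rw [hasEigenvalue_planarCLM_iff (by norm_num), ← sub_eq_zero (a := μ),
    ← sub_eq_zero (a := μ) (b := -20), ← mul_eq_zero]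
  ring_nf
end

section
/- The Fréchet derivative at the point (1, 1) of the map (X,Y) ↦ (P₋₁(X,Y), Q₋₁(X,Y)), defined on the open set {(X,Y) ∈ ℝ² : X > 0}, is the linear endomorphism of ℝ² given in the standard basis by the matrix [[−76, 24], [−36, 8]], and its eigenvalues are exactly −4 and −64; in particular both eigenvalues are negative, so (1, 1) is a linearly stable critical point of the ε = −1 rescaled Laplacian coflow system. -/
/-- The derivative at `(1, 1)` of the `ε = -1` rescaled Laplacian coflow vector field. -/
theorem hasFDerivAt_coflow_neg_one :
    HasFDerivAt (fun p : ℝ × ℝ => (coflowP (-1) p.1 p.2, coflowQ (-1) p.1 p.2))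
      (((-76 : ℝ) • ContinuousLinearMap.fst ℝ ℝ ℝ + (24 : ℝ) • ContinuousLinearMap.snd ℝ ℝ ℝ).prod
        ((-36 : ℝ) • ContinuousLinearMap.fst ℝ ℝ ℝ + (8 : ℝ) • ContinuousLinearMap.snd ℝ ℝ ℝ))
      ((1, 1) : ℝ × ℝ) := by
  have hX : HasFDerivAt (fun p : ℝ × ℝ => p.1) (ContinuousLinearMap.fst ℝ ℝ ℝ) (1, 1) :=
    hasFDerivAt_fst
  have hY : HasFDerivAt (fun p : ℝ × ℝ => p.2) (ContinuousLinearMap.snd ℝ ℝ ℝ) (1, 1) :=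
    hasFDerivAt_snd
  have hinv : HasFDerivAt (fun p : ℝ × ℝ => (p.1 ^ 2)⁻¹)
      ((-2 : ℝ) • ContinuousLinearMap.fst ℝ ℝ ℝ) (1, 1) := by
    have h : HasDerivAt (fun x : ℝ => (x ^ 2)⁻¹) (-2) 1 := by
      have h := (hasDerivAt_pow 2 (1 : ℝ)).inv (by norm_num)
      exact h.congr_deriv (by norm_num)
    exact HasDerivAt.comp_hasFDerivAt (f := fun p : ℝ × ℝ => p.1) (1, 1) h hX
  refine HasFDerivAt.prodMk ?_ ?_
  · simp only [coflowP, div_eq_mul_inv]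
    have h := (hinv.const_mul 4).mul
      ((((hX.add_const 1).mul (hY.pow 2)).add
        ((((((hX.pow 2).const_mul 2).sub (hX.const_mul 2)).sub_const 1).const_mul
          (2 * -1)).mul hX |>.mul hY)).sub
        ((((hX.pow 2).const_mul 2).mul ((hX.const_mul 2).sub_const 1)).mul
          (hX.add_const 1)))
    refine h.congr_fderiv ?_
    ext <;> simp <;> norm_num
  · simp only [coflowQ, div_eq_mul_inv]
    have h := ((hY.const_mul 4).mul hinv).mul
      (((((hX.const_sub 1).const_mul 2).mul (hY.pow 2)).add
        ((((((hX.pow 2).const_mul 2).sub (hX.const_mul 3)).sub_const 1).const_mul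
          (-1)).mul hY)).add
        ((hX.const_mul 2).mul ((hX.const_mul 2).const_sub 1)))
    refine h.congr_fderiv ?_
    ext <;> simp <;> norm_num

theorem coflow_linearization_eps_neg :
    (∀ v : ℝ × ℝ,
        fderiv ℝ (fun p : ℝ × ℝ => (coflowP (-1) p.1 p.2, coflowQ (-1) p.1 p.2))
          (1, 1) v
          = (-76 * v.1 + 24 * v.2, -36 * v.1 + 8 * v.2)) ∧
    (∀ μ : ℝ,
        Module.End.HasEigenvalue
          ((fderiv ℝ (fun p : ℝ × ℝ => (coflowP (-1) p.1 p.2, coflowQ (-1) p.1 p.2))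
              (1, 1)).toLinearMap) μ
          ↔ μ = -4 ∨ μ = -64) := by
  rw [hasFDerivAt_coflow_neg_one.fderiv]
  refine ⟨fun v => by simp, fun μ => ⟨fun h => ?_, fun h => ?_⟩⟩
  · obtain ⟨⟨x, y⟩, hv⟩ := h.exists_hasEigenvector
    have hxy := hv.apply_eq_smul
    have hne := hv.2
    simp only [ContinuousLinearMap.coe_coe, ContinuousLinearMap.prod_apply, add_apply,
      smul_apply, ContinuousLinearMap.coe_fst', ContinuousLinearMap.coe_snd', smul_eq_mul, Prod.smul_mk, Prod.mk.injEq] at hxy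
    obtain ⟨h₁, h₂⟩ := hxy
    have hx : (μ + 4) * (μ + 64) * x = 0 := by linear_combination (8 - μ) * h₁ - 24 * h₂
    have hy : (μ + 4) * (μ + 64) * y = 0 := by linear_combination 36 * h₁ - (μ + 76) * h₂
    have hμ : (μ + 4) * (μ + 64) = 0 := by
      by_contra hμ
      exact hne (Prod.ext ((mul_eq_zero.mp hx).resolve_left hμ)
        ((mul_eq_zero.mp hy).resolve_left hμ))
    exact (mul_eq_zero.mp hμ).imp eq_neg_of_add_eq_zero_left eq_neg_of_add_eq_zero_left
  · rcases h with rfl | rfl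
    · refine Module.End.hasEigenvalue_of_hasEigenvector (x := ((1, 3) : ℝ × ℝ))
        ⟨Module.End.mem_eigenspace_iff.mpr ?_, by simp⟩
      ext <;> simp <;> norm_num
    · refine Module.End.hasEigenvalue_of_hasEigenvector (x := ((2, 1) : ℝ × ℝ))
        ⟨Module.End.mem_eigenspace_iff.mpr ?_, by simp⟩
      ext <;> simp <;> norm_num
end

section
/- Let X, Y : ℝ → ℝ be differentiable functions such that X(s) > 0 and Y(s) > 0 for all s ≥ 0, and suppose that X′(s) = P₁(X(s), Y(s)) and Y′(s) = Q₁(X(s), Y(s)) for all s ≥ 0. Then (X(s), Y(s)) converges to (1/5, 1/5) as s → ∞. -/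
open Filter Topology Set

/-- The right-hand side of `X' / 4` in the coordinates `(X, u)` with `u = Y / X`. -/
noncomputable def ratioF (x u : ℝ) : ℝ :=
  (x + 1) * u ^ 2 + 2 * (2 * x ^ 2 - 2 * x - 1) * u - 2 * (2 * x - 1) * (x + 1)

/-- The factor of `u'` that does not vanish along the invariant line `u = 1`. -/
noncomputable def ratioH (x u : ℝ) : ℝ :=
  (2 * x ^ 2 - x + 1) * u + 2 * x * (2 * x - 1)

/-- The combination `F + 3 H` is positive on the whole quadrant. -/
theorem le_ratioF_add_ratioH {x u : ℝ} (hx : 0 < x) (hu : 0 < u) :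
    7 / 16 * u ^ 2 ≤ ratioF x u + 3 * ratioH x u := by
  have key : ratioF x u + 3 * ratioH x u =
      (x + 1) * u ^ 2 + (5 * x - 1) * (2 * x - 1) * u + 2 * (2 * x - 1) ^ 2 := by
    unfold ratioF ratioH; ring
  rw [key]
  rcases le_total (1 / 2) x with h | h
  · have h1 : 0 ≤ (5 * x - 1) * (2 * x - 1) * u :=
      mul_nonneg (mul_nonneg (by linarith) (by linarith)) hu.le
    nlinarith [sq_nonneg u, sq_nonneg (2 * x - 1)]
  · have h1 : (x + 1) * u ^ 2 + (5 * x - 1) * (2 * x - 1) * u + 2 * (2 * x - 1) ^ 2 =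
        2 * ((2 * x - 1) + (5 * x - 1) * u / 4) ^ 2
          + (7 + 25 * x) * (1 - x) / 8 * u ^ 2 := by ring
    have h2 : 7 / 16 ≤ (7 + 25 * x) * (1 - x) / 8 := by nlinarith
    rw [h1]
    nlinarith [sq_nonneg ((2 * x - 1) + (5 * x - 1) * u / 4),
      mul_le_mul_of_nonneg_right h2 (sq_nonneg u)]

theorem ratioF_pos {x u : ℝ} (hx : 0 < x) (hx' : x ≤ 1 / 10) (hu : 0 < u) :
    0 < ratioF x u := by
  unfold ratioF
  nlinarith [sq_nonneg (u - 1), mul_nonneg hx.le (sq_nonneg (u - 2)),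
    mul_nonneg (sq_nonneg x) hu.le]

theorem ratioH_pos {x u : ℝ} (hu : 1 ≤ u) : 0 < ratioH x u := by
  unfold ratioH
  nlinarith [sq_nonneg (x - 1 / 4), mul_nonneg (sub_nonneg.2 hu) (sq_nonneg (x - 1 / 4))]

theorem ratioF_sub_lt {x u : ℝ} (hx : 1 ≤ x) (hu : 0 < u) :
    ratioF x u - 2 / 3 * (u * (u - 1) * ratioH x u) < 0 := by
  obtain ⟨w, rfl⟩ : ∃ w, u = 1 + w := ⟨u - 1, by ring⟩
  have key : ratioF x (1 + w) - 2 / 3 * ((1 + w) * (1 + w - 1) * ratioH x (1 + w)) =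
      -(4 / 3) * w ^ 2 * (4 + w) * (x * (x - 1)) + x * (-5 - 5 / 3 * w ^ 2 - 2 / 3 * w ^ 3)
        + (1 - 2 / 3 * w - 1 / 3 * w ^ 2 - 2 / 3 * w ^ 3) := by
    unfold ratioF ratioH; ring
  have h1 : 0 ≤ w ^ 2 * (4 + w) * (x * (x - 1)) :=
    mul_nonneg (mul_nonneg (sq_nonneg w) (by linarith))
      (mul_nonneg (by linarith) (by linarith))
  have h2 : 0 ≤ w ^ 2 * (1 + w) := mul_nonneg (sq_nonneg w) hu.le
  have h3 : 0 ≤ x * (5 / 3 * w ^ 2 + 2 / 3 * w ^ 3) :=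
    mul_nonneg (by linarith) (by nlinarith [sq_nonneg w])
  have h4 : 1 - 2 / 3 * w - 1 / 3 * w ^ 2 - 2 / 3 * w ^ 3 ≤ 4 := by
    nlinarith [sq_nonneg w, sq_nonneg (w - 1)]
  rw [key]
  nlinarith

theorem le_of_deriv_neg_on_level {f f' : ℝ → ℝ} {c : ℝ}
    (hf : ∀ s, 0 ≤ s → HasDerivAt f (f' s) s) (h0 : f 0 ≤ c)
    (hneg : ∀ s, 0 ≤ s → f s = c → f' s < 0) {s : ℝ} (hs : 0 ≤ s) : f s ≤ c :=
  image_le_of_deriv_right_lt_deriv_boundary' (a := 0) (b := s) (B := fun _ => c)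
    (B' := fun _ => 0)
    (fun t ht => (hf t ht.1).continuousAt.continuousWithinAt)
    (fun t ht => (hf t ht.1).hasDerivWithinAt) h0 continuousOn_const
    (fun _ _ => hasDerivWithinAt_const ..)
    (fun t ht => hneg t ht.1) ⟨hs, le_rfl⟩

theorem le_mul_exp_of_deriv_le {f f' : ℝ → ℝ} {a s₀ : ℝ}
    (hf : ∀ s, s₀ ≤ s → HasDerivAt f (f' s) s) (h : ∀ s, s₀ ≤ s → f' s ≤ -a * f s)
    {s : ℝ} (hs : s₀ ≤ s) : f s ≤ f s₀ * Real.exp (-a * (s - s₀)) := by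
  have hd : ∀ t, s₀ ≤ t → HasDerivAt (fun t => f t * Real.exp (a * (t - s₀)))
      ((f' t + a * f t) * Real.exp (a * (t - s₀))) t := fun t ht => by
    have := (hf t ht).mul ((((hasDerivAt_id t).sub_const s₀).const_mul a).exp)
    exact this.congr_deriv (by simp only [id]; ring)
  have hanti : AntitoneOn (fun t => f t * Real.exp (a * (t - s₀))) (Ici s₀) := by
    refine antitoneOn_of_deriv_nonpos (convex_Ici s₀)
      (fun t ht => (hd t ht).continuousAt.continuousWithinAt)
      (fun t ht => (hd t (interior_subset ht)).differentiableAt.differentiableWithinAt)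
      (fun t ht => ?_)
    rw [(hd t (interior_subset ht)).deriv]
    exact mul_nonpos_of_nonpos_of_nonneg (by linarith [h t (interior_subset ht)])
      (Real.exp_pos _).le
  have h1 := hanti self_mem_Ici hs hs
  simp only [sub_self, mul_zero, Real.exp_zero, mul_one] at h1
  calc f s = f s * Real.exp (a * (s - s₀)) * Real.exp (-a * (s - s₀)) := by
        rw [mul_assoc, ← Real.exp_add]; simp
    _ ≤ _ := mul_le_mul_of_nonneg_right h1 (Real.exp_pos _).le

theorem tendsto_zero_of_deriv_le {f f' g : ℝ → ℝ} {a : ℝ} (ha : 0 < a)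
    (hf : ∀ s, 0 ≤ s → HasDerivAt f (f' s) s) (h0 : ∀ s, 0 ≤ s → 0 ≤ f s)
    (h : ∀ s, 0 ≤ s → f' s ≤ -a * f s + g s) (hg : Tendsto g atTop (𝓝 0)) :
    Tendsto f atTop (𝓝 0) := by
  rw [tendsto_order]
  refine ⟨fun ε hε => ?_, fun ε hε => ?_⟩
  · filter_upwards [eventually_ge_atTop 0] with s hs using hε.trans_le (h0 s hs)
  · have hε2 : 0 < a * (ε / 2) := by positivity
    obtain ⟨s₁, hs₁⟩ := eventually_atTop.1 (hg.eventually (gt_mem_nhds hε2))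
    set s₀ := max s₁ 0 with hs₀
    have hdecay : ∀ s, s₀ ≤ s →
        f s - ε / 2 ≤ (f s₀ - ε / 2) * Real.exp (-a * (s - s₀)) := fun s hs =>
      le_mul_exp_of_deriv_le (f := fun s => f s - ε / 2) (f' := f')
        (fun t ht => (hf t ((le_max_right _ _).trans ht)).sub_const _)
        (fun t ht => by
          have := h t ((le_max_right _ _).trans ht)
          have := hs₁ t ((le_max_left _ _).trans ht)
          linarith) hs
    have hlim : Tendsto (fun s => (f s₀ - ε / 2) * Real.exp (-a * (s - s₀))) atTop (𝓝 0) := by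
      have h1 : Tendsto (fun s => -a * (s - s₀)) atTop atBot :=
        (tendsto_atTop_add_const_right _ (-s₀) tendsto_id).const_mul_atTop_of_neg (by linarith)
      simpa using (Real.tendsto_exp_atBot.comp h1).const_mul (f s₀ - ε / 2)
    filter_upwards [hlim.eventually (gt_mem_nhds (half_pos hε)), eventually_ge_atTop s₀]
      with s h1 h2
    linarith [hdecay s h2]

theorem tendsto_zero_of_pow {f : ℝ → ℝ} {n : ℕ}
    (h : Tendsto (fun s => f s ^ n) atTop (𝓝 0)) : Tendsto f atTop (𝓝 0) := by
  rw [tendsto_zero_iff_abs_tendsto_zero, tendsto_order] at *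
  refine ⟨fun ε hε => Eventually.of_forall fun s => hε.trans_le (abs_nonneg _),
    fun ε hε => ?_⟩
  filter_upwards [h.2 (ε ^ n) (by positivity)] with s hs
  simp only [Function.comp_apply, abs_pow] at hs ⊢
  exact lt_of_pow_lt_pow_left₀ n hε.le hs

/-- Global attraction to `(1/5, 1)` in the coordinates `(X, Y / X)`. -/
theorem tendsto_of_ratio_flow {x u : ℝ → ℝ}
    (hx : ∀ s, 0 ≤ s → 0 < x s) (hu : ∀ s, 0 ≤ s → 0 < u s)
    (dx : ∀ s, 0 ≤ s → HasDerivAt x (4 * ratioF (x s) (u s)) s)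
    (du : ∀ s, 0 ≤ s →
      HasDerivAt u (-(4 * (u s * (u s - 1) * ratioH (x s) (u s)) / x s)) s) :
    Tendsto x atTop (𝓝 (1 / 5)) ∧ Tendsto u atTop (𝓝 1) := by
  obtain ⟨U, hU1, hU⟩ : ∃ U : ℝ, 0 < U ∧ ∀ s, 0 ≤ s → u s ≤ U := by
    refine ⟨max (u 0) 2, by positivity, fun s hs =>
      le_of_deriv_neg_on_level du (le_max_left _ _) (fun t ht h => ?_) hs⟩
    have h2 : 2 ≤ u t := h ▸ le_max_right _ _
    have := ratioH_pos (x := x t) (u := u t) (by linarith)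
    have := hx t ht
    have h3 : 0 < u t - 1 := by linarith
    have := hu t ht
    rw [neg_lt_zero]
    positivity
  obtain ⟨B, hB0, hB⟩ : ∃ B : ℝ, 0 < B ∧ ∀ s, 0 ≤ s → x s ≤ B := by
    set c := max (Real.log (x 0) + 2 / 3 * u 0) (2 / 3 * U) with hc
    refine ⟨Real.exp c, Real.exp_pos _, fun s hs => ?_⟩
    have hN : Real.log (x s) + 2 / 3 * u s ≤ c := by
      refine le_of_deriv_neg_on_level (f := fun s => Real.log (x s) + 2 / 3 * u s)
        (fun t ht => ((dx t ht).log (hx t ht).ne').add ((du t ht).const_mul (2 / 3)))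
        (le_max_left _ _) (fun t ht h => ?_) hs
      have h1 : 2 / 3 * U ≤ Real.log (x t) + 2 / 3 * u t := h ▸ le_max_right _ _
      have h2 : 1 ≤ x t := by
        by_contra! hlt
        have := Real.log_neg (hx t ht) hlt
        linarith [hU t ht]
      have h3 := ratioF_sub_lt h2 (hu t ht)
      have h4 := hx t ht
      have h5 : 4 * ratioF (x t) (u t) / x t +
          2 / 3 * -(4 * (u t * (u t - 1) * ratioH (x t) (u t)) / x t) =
          4 * (ratioF (x t) (u t) - 2 / 3 * (u t * (u t - 1) * ratioH (x t) (u t))) / x t := by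
        ring
      rw [h5]
      exact div_neg_of_neg_of_pos (by linarith) h4
    rw [← Real.log_le_iff_le_exp (hx s hs)]
    linarith [hu s hs]
  set W : ℝ → ℝ := fun s => (1 - u s) ^ 3 / (x s * u s ^ 3) with hW
  have dW : ∀ s, 0 ≤ s → HasDerivAt (fun s => W s ^ 2)
      (-8 * ((ratioF (x s) (u s) + 3 * ratioH (x s) (u s)) / x s) * W s ^ 2) s := by
    intro s hs
    have h1 := (hx s hs).ne'
    have h2 := (hu s hs).ne'
    have := ((((du s hs).const_sub 1).pow 3).div ((dx s hs).mul ((du s hs).pow 3))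
      (mul_ne_zero h1 (pow_ne_zero 3 h2))).pow 2
    refine this.congr_deriv ?_
    simp only [hW, Pi.pow_apply, Pi.mul_apply, Pi.div_apply, Nat.cast_ofNat, Nat.reduceSub]
    field_simp
    ring
  have hK : ∀ s, 0 ≤ s →
      0 ≤ (ratioF (x s) (u s) + 3 * ratioH (x s) (u s)) / x s := fun s hs =>
    div_nonneg (le_trans (by positivity) (le_ratioF_add_ratioH (hx s hs) (hu s hs))) (hx s hs).le
  have hWle : ∀ s, 0 ≤ s → W s ^ 2 ≤ W 0 ^ 2 := by
    intro s hs
    simpa using le_mul_exp_of_deriv_le (a := 0) dW (fun t ht => by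
      nlinarith [mul_nonneg (hK t ht) (sq_nonneg (W t))]) hs
  have hw6 : ∀ s, 0 ≤ s → (u s - 1) ^ 6 = W s ^ 2 * (x s ^ 2 * u s ^ 6) := by
    intro s hs
    have h1 := (hx s hs).ne'
    have h2 := (hu s hs).ne'
    simp only [hW]
    field_simp
    ring
  set M := W 0 ^ 2 * B ^ 2 with hM
  have hM0 : 0 ≤ M := by positivity
  have hlow : ∀ s, 0 ≤ s → 1 / (64 * (M + 1)) ≤ u s ^ 2 := by
    intro s hs
    have hus := hu s hs
    rw [div_le_iff₀ (by positivity)]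
    rcases le_total (1 / 2) (u s) with h | h
    · nlinarith [mul_nonneg hM0 (sq_nonneg (u s)), mul_self_le_mul_self (by norm_num) h]
    · have h1 : (u s - 1) ^ 6 ≤ M * u s ^ 6 := by
        rw [hw6 s hs, ← mul_assoc]
        refine mul_le_mul_of_nonneg_right ?_ (by positivity)
        exact mul_le_mul (hWle s hs) (pow_le_pow_left₀ (hx s hs).le (hB s hs) 2)
          (by positivity) (by positivity)
      have h2 : (1 / 2 : ℝ) ^ 6 ≤ (u s - 1) ^ 6 := by
        have := pow_le_pow_left₀ (by norm_num) (show (1 / 2 : ℝ) ≤ 1 - u s by linarith) 6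
        calc _ ≤ (1 - u s) ^ 6 := this
          _ = _ := by ring
      have h3 : u s ^ 6 ≤ u s ^ 2 := pow_le_pow_of_le_one hus.le (by linarith) (by norm_num)
      have h4 := mul_le_mul_of_nonneg_left h3 hM0
      nlinarith [sq_nonneg (u s)]
  have hWlim : Tendsto (fun s => W s ^ 2) atTop (𝓝 0) := by
    set c := 7 / 16 * (1 / (64 * (M + 1))) / B with hc
    refine tendsto_zero_of_deriv_le (a := 8 * c) (g := fun _ => 0) (by positivity) dW
      (fun s _ => sq_nonneg _) (fun s hs => ?_) tendsto_const_nhds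
    have h1 : c ≤ (ratioF (x s) (u s) + 3 * ratioH (x s) (u s)) / x s :=
      div_le_div₀ (le_trans (by positivity) (le_ratioF_add_ratioH (hx s hs) (hu s hs)))
        (le_trans (mul_le_mul_of_nonneg_left (hlow s hs) (by norm_num))
          (le_ratioF_add_ratioH (hx s hs) (hu s hs))) (hx s hs) (hB s hs)
    nlinarith [mul_le_mul_of_nonneg_right h1 (sq_nonneg (W s))]
  have hw : Tendsto (fun s => u s - 1) atTop (𝓝 0) := by
    refine tendsto_zero_of_pow (n := 6) ?_
    refine squeeze_zero' (Eventually.of_forall fun s => by positivity) ?_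
      (by simpa using hWlim.mul_const (B ^ 2 * U ^ 6))
    filter_upwards [eventually_ge_atTop 0] with s hs
    rw [hw6 s hs]
    have := hx s hs
    have := hu s hs
    have := hB s hs
    have := hU s hs
    gcongr
  refine ⟨?_, by simpa using hw.add_const 1⟩
  set r : ℝ → ℝ := fun s =>
    (u s - 1) * (4 * x s ^ 2 - 2 * x s + (x s + 1) * (u s - 1)) with hr
  have hr0 : Tendsto r atTop (𝓝 0) := by
    refine squeeze_zero_norm' (a := fun s => |u s - 1| *
      (4 * B ^ 2 + 2 * B + (B + 1) * (U + 1))) ?_ (by simpa using hw.abs.mul_const _)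
    filter_upwards [eventually_ge_atTop 0] with s hs
    rw [Real.norm_eq_abs, hr, abs_mul]
    refine mul_le_mul_of_nonneg_left ?_ (abs_nonneg _)
    have h1 := hx s hs
    have h2 := hu s hs
    have h3 := hB s hs
    have h4 := hU s hs
    have h5 : x s ^ 2 ≤ B ^ 2 := by gcongr
    have h6 : (x s + 1) * u s ≤ (B + 1) * U := by gcongr
    have h7 : 0 < (x s + 1) * u s := by positivity
    have h8 : 0 < B * U := by positivity
    rw [abs_le]
    constructor <;> nlinarith [sq_nonneg (x s)]
  have hd : Tendsto (fun s => (x s - 1 / 5) ^ 2) atTop (𝓝 0) := by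
    refine tendsto_zero_of_deriv_le (a := 20) (g := fun s => r s ^ 2) (by norm_num)
      (fun s hs => ((dx s hs).sub_const (1 / 5)).pow 2) (fun s _ => sq_nonneg _)
      (fun s hs => ?_) (by simpa using hr0.pow 2)
    have h1 : ratioF (x s) (u s) = -5 * (x s - 1 / 5) + r s := by
      simp only [hr, ratioF]; ring
    rw [h1]
    norm_num
    nlinarith [sq_nonneg (5 * (x s - 1 / 5) - r s), sq_nonneg (r s)]
  exact tendsto_sub_nhds_zero_iff.1 (tendsto_zero_of_pow hd)

theorem coflow_convergence_eps_pos (X Y : ℝ → ℝ)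
    (hXdiff : Differentiable ℝ X) (hYdiff : Differentiable ℝ Y)
    (hXpos : ∀ s : ℝ, 0 ≤ s → 0 < X s) (hYpos : ∀ s : ℝ, 0 ≤ s → 0 < Y s)
    (hX : ∀ s : ℝ, 0 ≤ s → deriv X s = coflowP 1 (X s) (Y s))
    (hY : ∀ s : ℝ, 0 ≤ s → deriv Y s = coflowQ 1 (X s) (Y s)) :
    Filter.Tendsto (fun s => (X s, Y s)) Filter.atTop
      (nhds ((1 / 5 : ℝ), (1 / 5 : ℝ))) := by
  have dX : ∀ s, 0 ≤ s → HasDerivAt X (4 * ratioF (X s) (Y s / X s)) s := by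
    intro s hs
    have h1 := (hXpos s hs).ne'
    refine (hXdiff s).hasDerivAt.congr_deriv ?_
    rw [hX s hs, coflowP, ratioF]
    field_simp
  have dU : ∀ s, 0 ≤ s → HasDerivAt (fun s => Y s / X s)
      (-(4 * (Y s / X s * (Y s / X s - 1) * ratioH (X s) (Y s / X s)) / X s)) s := by
    intro s hs
    have h1 := (hXpos s hs).ne'
    refine ((hYdiff s).hasDerivAt.div (dX s hs) h1).congr_deriv ?_
    rw [hY s hs, coflowQ, ratioF, ratioH]
    field_simp
    ring
  obtain ⟨hx, hu⟩ := tendsto_of_ratio_flow hXpos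
    (fun s hs => div_pos (hYpos s hs) (hXpos s hs)) dX dU
  refine hx.prodMk_nhds (Tendsto.congr' ?_ (by simpa using hu.mul hx))
  filter_upwards [eventually_ge_atTop 0] with s hs
  exact div_mul_cancel₀ _ (hXpos s hs).ne'
end

section
/- Let X, Y : ℝ → ℝ be differentiable functions such that X(s) > 0 and Y(s) > 0 for all s ≥ 0, and suppose that X′(s) = P₋₁(X(s), Y(s)) and Y′(s) = Q₋₁(X(s), Y(s)) for all s ≥ 0. Then (X(s), Y(s)) converges to (1, 1) as s → ∞. -/
open Set Filter Topology

/-- The polynomial with `Ẋ = 4 F(X, Z)` in the coordinates `(X, Z) = (X, Y / X)`. -/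
def coflowF (x z : ℝ) : ℝ :=
  (x + 1) * z ^ 2 - 2 * (2 * x ^ 2 - 2 * x - 1) * z - 2 * (2 * x - 1) * (x + 1)

/-- The polynomial with `Ż = 4 Z (Z + 1) / X * K(X, Z)` in the coordinates `(X, Z) = (X, Y / X)`. -/
def coflowK (x z : ℝ) : ℝ :=
  2 * (2 * x ^ 2 - x) - (2 * x ^ 2 - x + 1) * z

lemma tendsto_coflowF {u v : ℝ → ℝ} {l : Filter ℝ} {x z : ℝ} (hu : Tendsto u l (𝓝 x))
    (hv : Tendsto v l (𝓝 z)) :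
    Tendsto (fun s => coflowF (u s) (v s)) l (𝓝 (coflowF x z)) :=
  ((hu.add_const 1).mul (hv.pow 2)).sub
    ((((((hu.pow 2).const_mul 2).sub (hu.const_mul 2)).sub_const 1).const_mul 2).mul hv) |>.sub
    ((((hu.const_mul 2).sub_const 1).const_mul 2).mul (hu.add_const 1))

lemma tendsto_coflowK {u v : ℝ → ℝ} {l : Filter ℝ} {x z : ℝ} (hu : Tendsto u l (𝓝 x))
    (hv : Tendsto v l (𝓝 z)) :
    Tendsto (fun s => coflowK (u s) (v s)) l (𝓝 (coflowK x z)) :=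
  ((((hu.pow 2).const_mul 2).sub hu).const_mul 2).sub
    (((((hu.pow 2).const_mul 2).sub hu).add_const 1).mul hv)

lemma coflowK_factor_pos (x : ℝ) : 0 < 2 * x ^ 2 - x + 1 := by
  nlinarith [sq_nonneg (4 * x - 1)]

lemma half_lt_of_coflowF_nonpos {x z : ℝ} (hx : 0 < x) (hz : 0 < z) (h : coflowF x z ≤ 0) :
    1 / 2 < x := by
  by_contra! hle
  have h1 : 0 ≤ (1 - 2 * x) * (x + 1) := mul_nonneg (by linarith) (by linarith)
  have h2 : 0 < (x + 1) * z ^ 2 := by positivity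
  have h3 : 0 ≤ (1 + 2 * x * (1 - x)) * z :=
    mul_nonneg (by nlinarith [mul_nonneg hx.le (show 0 ≤ 1 - x by linarith)]) hz.le
  unfold coflowF at h
  nlinarith

lemma half_lt_of_coflowK_nonneg {x z : ℝ} (hx : 0 < x) (hz : 0 < z) (h : 0 ≤ coflowK x z) :
    1 / 2 < x := by
  have h1 := mul_pos (coflowK_factor_pos x) hz
  unfold coflowK at h
  by_contra! hle
  nlinarith [mul_nonneg hx.le (show 0 ≤ 1 - 2 * x by linarith)]

lemma half_lt_of_mul_nonneg {x z : ℝ} (hx : 0 < x) (hz : 0 < z)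
    (h : 0 ≤ coflowF x z * coflowK x z) : 1 / 2 < x := by
  rcases le_or_gt (coflowF x z) 0 with hF | hF
  · exact half_lt_of_coflowF_nonpos hx hz hF
  · exact half_lt_of_coflowK_nonneg hx hz (nonneg_of_mul_nonneg_right h hF)

lemma le_two_of_coflowK_nonneg {x z : ℝ} (h : 0 ≤ coflowK x z) : z ≤ 2 := by
  by_contra! hlt
  have h1 := mul_lt_mul_of_pos_left hlt (coflowK_factor_pos x)
  unfold coflowK at h
  linarith

lemma le_of_coflowF_nonneg {x z C : ℝ} (hz : 0 < z) (hzC : z ≤ C)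
    (h : 0 ≤ coflowF x z) : x ≤ 1 + C + C ^ 2 := by
  by_contra! hlt
  have hC : 0 < C := hz.trans_le hzC
  have hx1 : 1 < x := by nlinarith
  have h1 : (x + 1) * z ^ 2 ≤ (x + 1) * C ^ 2 := by gcongr
  have h2 : -(2 * (2 * x ^ 2 - 2 * x - 1) * z) ≤ 2 * C := by
    nlinarith [mul_pos (mul_pos (show 0 < x by linarith) (sub_pos.2 hx1)) hz]
  have h3 : (x + 1) * (1 + C + C ^ 2) < (x + 1) * x := by gcongr
  unfold coflowF at h
  nlinarith [mul_pos (show 0 < x + 1 by linarith) (sub_pos.2 hx1), mul_pos hC (sub_pos.2 hx1)]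

/-- On the nullcline `K = 0` the sign of `F` is that of `1 - x`. -/
lemma coflowF_on_nullcline (x : ℝ) :
    (2 * x ^ 2 - x + 1) ^ 2 * coflowF x (2 * (2 * x ^ 2 - x) / (2 * x ^ 2 - x + 1)) =
      2 * (2 * x - 1) ^ 2 * (1 - x) * (6 * x ^ 3 + x ^ 2 + 1) := by
  have e := div_mul_cancel₀ (2 * (2 * x ^ 2 - x)) (coflowK_factor_pos x).ne'
  set h := 2 * (2 * x ^ 2 - x) / (2 * x ^ 2 - x + 1)
  unfold coflowF
  linear_combination ((x + 1) * (h * (2 * x ^ 2 - x + 1) + 2 * (2 * x ^ 2 - x))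
    - 2 * (2 * x ^ 2 - 2 * x - 1) * (2 * x ^ 2 - x + 1)) * e

lemma one_le_of_nonpos_of_nonpos {x z : ℝ} (hx : 0 < x) (hz : 0 < z) (hF : coflowF x z ≤ 0)
    (hK : coflowK x z ≤ 0) : 1 ≤ x := by
  have hx2 := half_lt_of_coflowF_nonpos hx hz hF
  have hM := coflowK_factor_pos x
  have hnull := coflowF_on_nullcline x
  set h := 2 * (2 * x ^ 2 - x) / (2 * x ^ 2 - x + 1) with hdef
  have hh : 0 < h := div_pos (by nlinarith) hM
  have hhz : h ≤ z := by
    rw [hdef, div_le_iff₀ hM]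
    unfold coflowK at hK
    linarith
  have hF0 : coflowF x 0 ≤ 0 := by
    unfold coflowF
    nlinarith
  have hconv : z * coflowF x h =
      h * coflowF x z + (z - h) * coflowF x 0 - (x + 1) * h * z * (z - h) := by
    unfold coflowF
    ring
  have hneg : z * coflowF x h ≤ 0 := by
    rw [hconv]
    have h1 := mul_nonpos_of_nonneg_of_nonpos hh.le hF
    have h2 := mul_nonpos_of_nonneg_of_nonpos (sub_nonneg.2 hhz) hF0
    have h3 : 0 ≤ (x + 1) * h * z * (z - h) :=
      mul_nonneg (by positivity) (sub_nonneg.2 hhz)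
    linarith
  have hFh : coflowF x h ≤ 0 := nonpos_of_mul_nonpos_right hneg hz
  by_contra! hlt
  have hpos : 0 < 2 * (2 * x - 1) ^ 2 * (1 - x) * (6 * x ^ 3 + x ^ 2 + 1) := by
    have : 0 < 2 * x - 1 := by linarith
    have : 0 < 1 - x := by linarith
    positivity
  rw [← hnull] at hpos
  exact absurd (pos_of_mul_pos_right hpos (by positivity)) (not_lt.2 hFh)

lemma eq_one_of_coflow_eq_zero {x z : ℝ} (hx : 0 < x) (hz : 0 < z) (hF : coflowF x z = 0)
    (hK : coflowK x z = 0) : x = 1 ∧ z = 1 := by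
  have hM := coflowK_factor_pos x
  have hz' : z = 2 * (2 * x ^ 2 - x) / (2 * x ^ 2 - x + 1) := by
    rw [eq_div_iff hM.ne']
    unfold coflowK at hK
    linarith
  have hnull := coflowF_on_nullcline x
  rw [← hz', hF, mul_zero] at hnull
  have h1 : 0 < 2 * x - 1 := by
    linarith [half_lt_of_coflowF_nonpos hx hz hF.le]
  have h2 : 2 * (2 * x - 1) ^ 2 * (6 * x ^ 3 + x ^ 2 + 1) ≠ 0 := by positivity
  have hx1 : x = 1 := by
    have : 2 * (2 * x - 1) ^ 2 * (6 * x ^ 3 + x ^ 2 + 1) * (1 - x) = 0 := by linarith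
    linarith [(mul_eq_zero.1 this).resolve_left h2]
  subst hx1
  exact ⟨rfl, by rw [hz']; norm_num⟩

/-- Near the boundary equilibrium `(1/2, 0)`, from the left, `log Z` decreases at most as fast as
`4 X` increases. -/
lemma coflowK_lower_bound {x z : ℝ} (hx : 1 / 4 ≤ x) (hx' : x ≤ 1 / 2) (hz : 0 < z) (hz1 : z ≤ 1) :
    0 ≤ 4 * z * (z + 1) / x * coflowK x z + 16 * coflowF x z * z := by
  have hx0 : 0 < x := by linarith
  have hs : 0 ≤ z + (1 - 2 * x) := by linarith
  have hK : -(z + (1 - 2 * x)) ≤ coflowK x z := by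
    unfold coflowK
    nlinarith [mul_nonneg (mul_nonneg hx0.le (show 0 ≤ 1 - 2 * x by linarith)) hz.le,
      sq_nonneg (1 - 2 * x)]
  have hF : 2 * (z + (1 - 2 * x)) ≤ coflowF x z := by
    unfold coflowF
    nlinarith [mul_nonneg (mul_nonneg hx0.le (show 0 ≤ 1 - x by linarith)) hz.le,
      mul_nonneg hx0.le (show 0 ≤ 1 - 2 * x by linarith),
      mul_nonneg (show 0 ≤ x + 1 by linarith) (sq_nonneg z)]
  have hc : (z + 1) / x ≤ 8 := by
    rw [div_le_iff₀ hx0]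
    linarith
  have hc0 : 0 ≤ (z + 1) / x := by positivity
  have h1 : -(8 * (z + (1 - 2 * x))) ≤ (z + 1) / x * coflowK x z := by
    nlinarith [mul_le_mul_of_nonneg_left hK hc0, mul_le_mul_of_nonneg_right hc hs]
  have h2 : 0 ≤ 4 * z * ((z + 1) / x * coflowK x z + 4 * coflowF x z) :=
    mul_nonneg (by positivity) (by linarith)
  calc 0 ≤ 4 * z * ((z + 1) / x * coflowK x z + 4 * coflowF x z) := h2
    _ = _ := by ring

lemma exists_integrating_factor {w w' A : ℝ → ℝ} {a : ℝ} (hA : ContinuousOn A (Ici a))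
    (hw : ∀ s, a ≤ s → HasDerivAt w (w' s) s) (h : ∀ s, a ≤ s → A s * w s ≤ w' s) :
    ∃ E : ℝ → ℝ, (∀ s, 0 < E s) ∧ MonotoneOn (fun s => E s * w s) (Ici a) := by
  have hB : Continuous fun s => A (max a s) :=
    hA.comp_continuous (by fun_prop) fun s => le_max_left a s
  refine ⟨fun s => Real.exp (-∫ t in a..s, A (max a t)), fun s => Real.exp_pos _, ?_⟩
  have hd : ∀ s, a ≤ s → HasDerivAt (fun s => Real.exp (-∫ t in a..s, A (max a t)) * w s)
      (Real.exp (-∫ t in a..s, A (max a t)) * -A s * w s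
        + Real.exp (-∫ t in a..s, A (max a t)) * w' s) s := by
    intro s hs
    have hI : HasDerivAt (fun s => ∫ t in a..s, A (max a t)) (A s) s := by
      have := intervalIntegral.integral_hasDerivAt_right (hB.intervalIntegrable a s)
        (hB.stronglyMeasurableAtFilter _ _) hB.continuousAt
      rwa [max_eq_right hs] at this
    exact hI.neg.exp.mul (hw s hs)
  refine monotoneOn_of_hasDerivWithinAt_nonneg (convex_Ici a)
    (fun s hs => (hd s hs).continuousAt.continuousWithinAt)
    (fun s hs => (hd s (interior_subset hs)).hasDerivWithinAt) fun s hs => ?_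
  have h1 := mul_nonneg (Real.exp_pos (-∫ t in a..s, A (max a t))).le
    (sub_nonneg.2 (h s (interior_subset hs)))
  linarith

lemma nonneg_of_linear_le_deriv {w w' A : ℝ → ℝ} {a : ℝ} (hA : ContinuousOn A (Ici a))
    (hw : ∀ s, a ≤ s → HasDerivAt w (w' s) s) (h : ∀ s, a ≤ s → A s * w s ≤ w' s)
    (ha : 0 ≤ w a) : ∀ s, a ≤ s → 0 ≤ w s := by
  obtain ⟨E, hE, hmono⟩ := exists_integrating_factor hA hw h
  intro s hs
  have h1 : E a * w a ≤ E s * w s := hmono self_mem_Ici hs hs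
  exact nonneg_of_mul_nonneg_right ((mul_nonneg (hE a).le ha).trans h1) (hE s)

lemma pos_of_linear_le_deriv {w w' A : ℝ → ℝ} {a : ℝ} (hA : ContinuousOn A (Ici a))
    (hw : ∀ s, a ≤ s → HasDerivAt w (w' s) s) (h : ∀ s, a ≤ s → A s * w s ≤ w' s)
    (ha : 0 < w a) : ∀ s, a ≤ s → 0 < w s := by
  obtain ⟨E, hE, hmono⟩ := exists_integrating_factor hA hw h
  intro s hs
  have h1 : E a * w a ≤ E s * w s := hmono self_mem_Ici hs hs
  exact pos_of_mul_pos_right ((mul_pos (hE a) ha).trans_le h1) (hE s).le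

lemma nonneg_or_nonpos_of_ne_zero {u : ℝ → ℝ} {a : ℝ} (hu : ContinuousOn u (Ici a))
    (h : ∀ s, a ≤ s → u s ≠ 0) : (∀ s, a ≤ s → 0 ≤ u s) ∨ (∀ s, a ≤ s → u s ≤ 0) := by
  by_contra! hcon
  obtain ⟨⟨s, hs, hus⟩, t, ht, hut⟩ := hcon
  obtain ⟨r, hr, hr0⟩ := isPreconnected_Ici.intermediate_value hs ht hu ⟨hus.le, hut.le⟩
  exact h r hr hr0

lemma monotoneOn_Ici_of_hasDerivAt {u u' : ℝ → ℝ} {a : ℝ}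
    (hu : ∀ s, a ≤ s → HasDerivAt u (u' s) s) (h : ∀ s, a ≤ s → 0 ≤ u' s) :
    MonotoneOn u (Ici a) :=
  monotoneOn_of_hasDerivWithinAt_nonneg (convex_Ici a)
    (fun s hs => (hu s hs).continuousAt.continuousWithinAt)
    (fun s hs => (hu s (interior_subset hs)).hasDerivWithinAt)
    fun s hs => h s (interior_subset hs)

lemma antitoneOn_Ici_of_hasDerivAt {u u' : ℝ → ℝ} {a : ℝ}
    (hu : ∀ s, a ≤ s → HasDerivAt u (u' s) s) (h : ∀ s, a ≤ s → u' s ≤ 0) :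
    AntitoneOn u (Ici a) :=
  antitoneOn_of_hasDerivWithinAt_nonpos (convex_Ici a)
    (fun s hs => (hu s hs).continuousAt.continuousWithinAt)
    (fun s hs => (hu s (interior_subset hs)).hasDerivWithinAt)
    fun s hs => h s (interior_subset hs)

lemma MonotoneOn.exists_tendsto_atTop {u : ℝ → ℝ} {a C : ℝ} (hu : MonotoneOn u (Ici a))
    (hC : ∀ s, a ≤ s → u s ≤ C) : ∃ l, Tendsto u atTop (𝓝 l) := by
  have hmono : Monotone fun s => u (max a s) := fun s t hst =>
    hu (le_max_left a s) (le_max_left a t) (max_le_max_left a hst)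
  have hb : BddAbove (range fun s => u (max a s)) :=
    ⟨C, by rintro _ ⟨s, rfl⟩; exact hC _ (le_max_left a s)⟩
  refine ⟨_, (tendsto_atTop_ciSup hmono hb).congr' ?_⟩
  filter_upwards [eventually_ge_atTop a] with s hs
  rw [max_eq_right hs]

lemma AntitoneOn.exists_tendsto_atTop {u : ℝ → ℝ} {a C : ℝ} (hu : AntitoneOn u (Ici a))
    (hC : ∀ s, a ≤ s → C ≤ u s) : ∃ l, Tendsto u atTop (𝓝 l) := by
  obtain ⟨l, hl⟩ := hu.neg.exists_tendsto_atTop (C := -C) fun s hs => neg_le_neg (hC s hs)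
  exact ⟨-l, by simpa using hl.neg⟩

lemma deriv_limit_eq_zero {u u' : ℝ → ℝ} {a l L : ℝ}
    (hu : ∀ s, a ≤ s → HasDerivAt u (u' s) s) (hl : Tendsto u atTop (𝓝 l))
    (hL : Tendsto u' atTop (𝓝 L)) : L = 0 := by
  have hex : ∀ s, ∃ c, s ≤ c ∧ (a ≤ s → u' c = u (s + 1) - u s) := by
    intro s
    by_cases hs : a ≤ s
    · obtain ⟨c, hc, hc'⟩ := exists_hasDerivAt_eq_slope u u' (lt_add_one s)
        (fun t ht => (hu t (hs.trans ht.1)).continuousAt.continuousWithinAt)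
        (fun t ht => hu t (hs.trans ht.1.le))
      exact ⟨c, hc.1.le, fun _ => by rw [hc']; ring⟩
    · exact ⟨s, le_rfl, fun h => absurd h hs⟩
  choose c hc hc' using hex
  have h1 : Tendsto (fun s => u' (c s)) atTop (𝓝 L) :=
    hL.comp (tendsto_atTop_mono hc tendsto_id)
  have h2 : Tendsto (fun s => u (s + 1) - u s) atTop (𝓝 (l - l)) :=
    (hl.comp (tendsto_atTop_add_const_right _ 1 tendsto_id)).sub hl
  rw [sub_self] at h2
  refine tendsto_nhds_unique h1 (h2.congr' ?_)
  filter_upwards [eventually_ge_atTop a] with s hs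
  exact (hc' s hs).symm

section Flow

variable {X Z : ℝ → ℝ}

lemma half_lt_forward (hZpos : ∀ s, 0 ≤ s → 0 < Z s)
    (hX : ∀ s, 0 ≤ s → HasDerivAt X (4 * coflowF (X s) (Z s)) s)
    (hZ : ∀ s, 0 ≤ s →
      HasDerivAt Z (4 * Z s * (Z s + 1) / X s * coflowK (X s) (Z s)) s)
    {a : ℝ} (ha : 0 ≤ a) (h : 1 / 2 < X a) : ∀ s, a ≤ s → 1 / 2 < X s := by
  have hXc : ContinuousOn X (Ici a) := fun s hs =>
    (hX s (ha.trans hs)).continuousAt.continuousWithinAt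
  have hZc : ContinuousOn Z (Ici a) := fun s hs =>
    (hZ s (ha.trans hs)).continuousAt.continuousWithinAt
  have key := pos_of_linear_le_deriv (w := fun s => X s - 1 / 2)
    (A := fun s => 4 * (Z s ^ 2 - 4 * Z s * (X s - 1 / 2) - 4 * (X s + 1))) (a := a)
    (by fun_prop) (fun s hs => (hX s (ha.trans hs)).sub_const _)
    (fun s hs => by
      have := hZpos s (ha.trans hs)
      have h1 : 0 ≤ 4 * (3 / 2 * Z s ^ 2 + 3 * Z s) := by positivity
      unfold coflowF
      linarith)
    (by linarith)
  intro s hs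
  linarith [key s hs]

lemma hasDerivAt_coflowF_mul_coflowK {s : ℝ} (hXs : 1 / 2 < X s) (hZs : 0 < Z s)
    (hX : HasDerivAt X (4 * coflowF (X s) (Z s)) s)
    (hZ : HasDerivAt Z (4 * Z s * (Z s + 1) / X s * coflowK (X s) (Z s)) s) :
    HasDerivAt (fun s => coflowF (X s) (Z s) * coflowK (X s) (Z s))
      ((4 * (Z s ^ 2 - 2 * Z s * (4 * X s - 2) - 2 * (4 * X s + 1))
          + 4 * (Z s + 1) / X s * coflowK (X s) (Z s)
          + 4 * (4 * X s - 1) / (2 * X s ^ 2 - X s) * coflowF (X s) (Z s)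
          - (2 * X s ^ 2 - X s + 1) * (4 * Z s * (Z s + 1) / X s))
          * (coflowF (X s) (Z s) * coflowK (X s) (Z s))
        + (4 * (Z s + 1) / X s * ((X s + 1) * Z s ^ 2 + 2 * (2 * X s - 1) * (X s + 1))
            * coflowK (X s) (Z s) ^ 2
          + 4 * (4 * X s - 1) * Z s / (2 * X s ^ 2 - X s) * coflowF (X s) (Z s) ^ 2)) s := by
  set f := coflowF (X s) (Z s) with hf
  set k := coflowK (X s) (Z s) with hk
  have hF : HasDerivAt (fun s => coflowF (X s) (Z s))
      ((Z s ^ 2 - 2 * Z s * (4 * X s - 2) - 2 * (4 * X s + 1)) * (4 * f)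
        + (2 * (X s + 1) * Z s - 2 * (2 * X s ^ 2 - 2 * X s - 1))
          * (4 * Z s * (Z s + 1) / X s * k)) s := by
    unfold coflowF
    refine HasDerivAt.congr_deriv ((((hX.add_const 1).mul (hZ.pow 2)).sub
      ((((((hX.pow 2).const_mul 2).sub (hX.const_mul 2)).sub_const 1).const_mul 2).mul hZ)).sub
      ((((hX.const_mul 2).sub_const 1).const_mul 2).mul (hX.add_const 1))) ?_
    simp only [Pi.pow_apply, Pi.sub_apply]
    ring
  have hK : HasDerivAt (fun s => coflowK (X s) (Z s))
      ((4 * X s - 1) * (2 - Z s) * (4 * f)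
        - (2 * X s ^ 2 - X s + 1) * (4 * Z s * (Z s + 1) / X s * k)) s := by
    unfold coflowK
    refine HasDerivAt.congr_deriv (((((hX.pow 2).const_mul 2).sub hX).const_mul 2).sub
      (((((hX.pow 2).const_mul 2).sub hX).add_const 1).mul hZ)) ?_
    simp only [Pi.pow_apply, Pi.sub_apply]
    ring
  have hm : 0 < 2 * X s - 1 := by linarith
  have hXpos : 0 < X s := by linarith
  have e1 : 2 * (X s + 1) * Z s - 2 * (2 * X s ^ 2 - 2 * X s - 1) =
      (f + ((X s + 1) * Z s ^ 2 + 2 * (2 * X s - 1) * (X s + 1))) / Z s := by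
    rw [eq_div_iff hZs.ne', hf, coflowF]
    ring
  have e2 : 2 - Z s = (k + Z s) / (2 * X s ^ 2 - X s) := by
    rw [eq_div_iff (by nlinarith), hk, coflowK]
    ring
  rw [e1] at hF
  rw [e2] at hK
  refine (hF.mul hK).congr_deriv ?_
  rw [← hf, ← hk]
  have e3 : 2 * X s ^ 2 - X s = X s * (2 * X s - 1) := by ring
  rw [e3]
  field_simp
  ring

/-- The signs of `Ẋ` and `Ż` are eventually constant along a trajectory. -/
lemma eventually_constant_signs (hXpos : ∀ s, 0 ≤ s → 0 < X s) (hZpos : ∀ s, 0 ≤ s → 0 < Z s)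
    (hX : ∀ s, 0 ≤ s → HasDerivAt X (4 * coflowF (X s) (Z s)) s)
    (hZ : ∀ s, 0 ≤ s →
      HasDerivAt Z (4 * Z s * (Z s + 1) / X s * coflowK (X s) (Z s)) s) :
    ∃ T, 0 ≤ T ∧
      ((∀ s, T ≤ s → 0 ≤ coflowF (X s) (Z s)) ∨ (∀ s, T ≤ s → coflowF (X s) (Z s) ≤ 0)) ∧
      ((∀ s, T ≤ s → 0 ≤ coflowK (X s) (Z s)) ∨ (∀ s, T ≤ s → coflowK (X s) (Z s) ≤ 0)) := by
  have hXc : ∀ {a}, 0 ≤ a → ContinuousOn X (Ici a) := fun ha s hs =>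
    (hX s (ha.trans hs)).continuousAt.continuousWithinAt
  have hZc : ∀ {a}, 0 ≤ a → ContinuousOn Z (Ici a) := fun ha s hs =>
    (hZ s (ha.trans hs)).continuousAt.continuousWithinAt
  have hFc : ∀ {a}, 0 ≤ a → ContinuousOn (fun s => coflowF (X s) (Z s)) (Ici a) := by
    intro a ha
    have := hXc ha
    have := hZc ha
    unfold coflowF
    fun_prop
  have hKc : ∀ {a}, 0 ≤ a → ContinuousOn (fun s => coflowK (X s) (Z s)) (Ici a) := by
    intro a ha
    have := hXc ha
    have := hZc ha
    unfold coflowK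
    fun_prop
  have hsigns : ∀ {a}, 0 ≤ a → (∀ s, a ≤ s → coflowF (X s) (Z s) * coflowK (X s) (Z s) ≠ 0) →
      ∃ T, 0 ≤ T ∧
      ((∀ s, T ≤ s → 0 ≤ coflowF (X s) (Z s)) ∨ (∀ s, T ≤ s → coflowF (X s) (Z s) ≤ 0)) ∧
      ((∀ s, T ≤ s → 0 ≤ coflowK (X s) (Z s)) ∨ (∀ s, T ≤ s → coflowK (X s) (Z s) ≤ 0)) :=
    fun {a} ha h => ⟨a, ha,
      nonneg_or_nonpos_of_ne_zero (hFc ha) fun s hs => left_ne_zero_of_mul (h s hs),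
      nonneg_or_nonpos_of_ne_zero (hKc ha) fun s hs => right_ne_zero_of_mul (h s hs)⟩
  by_cases hneg : ∀ s, 0 ≤ s → coflowF (X s) (Z s) * coflowK (X s) (Z s) < 0
  · exact hsigns le_rfl fun s hs => (hneg s hs).ne
  push Not at hneg
  obtain ⟨a, ha, hwa⟩ := hneg
  have hhalf := half_lt_forward hZpos hX hZ ha
    (half_lt_of_mul_nonneg (hXpos a ha) (hZpos a ha) hwa)
  have hd := fun s (hs : a ≤ s) => hasDerivAt_coflowF_mul_coflowK (hhalf s hs)
    (hZpos s (ha.trans hs)) (hX s (ha.trans hs)) (hZ s (ha.trans hs))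
  have hcF : ∀ s, a ≤ s → 0 < 4 * (4 * X s - 1) * Z s / (2 * X s ^ 2 - X s) := by
    intro s hs
    have h1 := hhalf s hs
    have h2 := hZpos s (ha.trans hs)
    have h3 : 0 < 4 * X s - 1 := by linarith
    have h4 : 0 < 2 * X s ^ 2 - X s := by nlinarith
    positivity
  have hcK : ∀ s, a ≤ s →
      0 < 4 * (Z s + 1) / X s * ((X s + 1) * Z s ^ 2 + 2 * (2 * X s - 1) * (X s + 1)) := by
    intro s hs
    have h1 := hhalf s hs
    have h2 := hZpos s (ha.trans hs)
    have h3 : 0 < 2 * X s - 1 := by linarith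
    have h4 : 0 < X s := by linarith
    positivity
  have hle := fun s (hs : a ≤ s) => le_add_of_nonneg_right
    (a := (4 * (Z s ^ 2 - 2 * Z s * (4 * X s - 2) - 2 * (4 * X s + 1))
          + 4 * (Z s + 1) / X s * coflowK (X s) (Z s)
          + 4 * (4 * X s - 1) / (2 * X s ^ 2 - X s) * coflowF (X s) (Z s)
          - (2 * X s ^ 2 - X s + 1) * (4 * Z s * (Z s + 1) / X s))
          * (coflowF (X s) (Z s) * coflowK (X s) (Z s)))
    (add_nonneg (mul_nonneg (hcK s hs).le (sq_nonneg (coflowK (X s) (Z s))))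
      (mul_nonneg (hcF s hs).le (sq_nonneg (coflowF (X s) (Z s)))))
  have hA : ContinuousOn (fun s => 4 * (Z s ^ 2 - 2 * Z s * (4 * X s - 2) - 2 * (4 * X s + 1))
          + 4 * (Z s + 1) / X s * coflowK (X s) (Z s)
          + 4 * (4 * X s - 1) / (2 * X s ^ 2 - X s) * coflowF (X s) (Z s)
          - (2 * X s ^ 2 - X s + 1) * (4 * Z s * (Z s + 1) / X s)) (Ici a) := by
    have h1 := hXc ha
    have h2 := hZc ha
    have h3 := hFc ha
    have h4 := hKc ha
    have h5 : ∀ s ∈ Ici a, X s ≠ 0 := fun s hs => (hXpos s (ha.trans hs)).ne'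
    have h6 : ∀ s ∈ Ici a, 2 * X s ^ 2 - X s ≠ 0 := fun s hs => by
      have := hhalf s hs
      nlinarith
    fun_prop (disch := assumption)
  by_cases hpos : ∃ b, a ≤ b ∧ 0 < coflowF (X b) (Z b) * coflowK (X b) (Z b)
  · obtain ⟨b, hb, hwb⟩ := hpos
    have h1 := pos_of_linear_le_deriv (hA.mono (Ici_subset_Ici.2 hb))
      (fun s hs => hd s (hb.trans hs)) (fun s hs => hle s (hb.trans hs)) hwb
    exact hsigns (ha.trans hb) fun s hs => (h1 s hs).ne'
  push Not at hpos
  have hw0 : ∀ s, a ≤ s → coflowF (X s) (Z s) * coflowK (X s) (Z s) = 0 := fun s hs =>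
    le_antisymm (hpos s hs) (nonneg_of_linear_le_deriv hA hd hle hwa s hs)
  have hzero : ∀ s, a + 1 ≤ s → coflowF (X s) (Z s) = 0 ∧ coflowK (X s) (Z s) = 0 := by
    intro s hs
    have hs' : a < s := by linarith
    have h1 : HasDerivAt (fun s => coflowF (X s) (Z s) * coflowK (X s) (Z s)) 0 s := by
      refine (hasDerivAt_const s (0 : ℝ)).congr_of_eventuallyEq ?_
      filter_upwards [Ioi_mem_nhds hs'] with t ht
      exact hw0 t (le_of_lt ht)
    have h2 := (hd s hs'.le).unique h1
    rw [hw0 s hs'.le, mul_zero, zero_add] at h2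
    have h3 := mul_nonneg (hcK s hs'.le).le (sq_nonneg (coflowK (X s) (Z s)))
    have h4 := mul_nonneg (hcF s hs'.le).le (sq_nonneg (coflowF (X s) (Z s)))
    obtain ⟨h5, h6⟩ := (add_eq_zero_iff_of_nonneg h3 h4).1 h2
    exact ⟨pow_eq_zero_iff two_ne_zero |>.1 ((mul_eq_zero.1 h6).resolve_left (hcF s hs'.le).ne'),
      pow_eq_zero_iff two_ne_zero |>.1 ((mul_eq_zero.1 h5).resolve_left (hcK s hs'.le).ne')⟩
  exact ⟨a + 1, by linarith, Or.inl fun s hs => (hzero s hs).1.ge,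
    Or.inl fun s hs => (hzero s hs).2.ge⟩

lemma not_tendsto_boundary_equilibrium (hXpos : ∀ s, 0 ≤ s → 0 < X s)
    (hZpos : ∀ s, 0 ≤ s → 0 < Z s)
    (hX : ∀ s, 0 ≤ s → HasDerivAt X (4 * coflowF (X s) (Z s)) s)
    (hZ : ∀ s, 0 ≤ s →
      HasDerivAt Z (4 * Z s * (Z s + 1) / X s * coflowK (X s) (Z s)) s)
    {T : ℝ} (hT : 0 ≤ T)
    (hF : (∀ s, T ≤ s → 0 ≤ coflowF (X s) (Z s)) ∨ (∀ s, T ≤ s → coflowF (X s) (Z s) ≤ 0))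
    (hK : ∀ s, T ≤ s → coflowK (X s) (Z s) ≤ 0)
    (hXlim : Tendsto X atTop (𝓝 (1 / 2))) (hZlim : Tendsto Z atTop (𝓝 0)) : False := by
  rcases hF with hF | hF
  · have hmono := monotoneOn_Ici_of_hasDerivAt (fun s hs => hX s (hT.trans hs))
      fun s hs => mul_nonneg zero_le_four (hF s hs)
    have hle : ∀ s, T ≤ s → X s ≤ 1 / 2 := fun s hs => by
      refine ge_of_tendsto hXlim ?_
      filter_upwards [eventually_ge_atTop s] with t ht
      exact hmono hs (mem_Ici.2 (le_trans hs ht)) ht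
    obtain ⟨S, hS⟩ := eventually_atTop.1 ((eventually_ge_atTop T).and
      ((hXlim.eventually (lt_mem_nhds (show (1 / 4 : ℝ) < 1 / 2 by norm_num))).and
        (hZlim.eventually (gt_mem_nhds one_pos))))
    have hTS : T ≤ S := (hS S le_rfl).1
    have hE : MonotoneOn (fun s => Z s * Real.exp (4 * X s)) (Ici S) := by
      refine monotoneOn_Ici_of_hasDerivAt (fun s hs =>
        (hZ s (hT.trans (hTS.trans hs))).mul
          ((hX s (hT.trans (hTS.trans hs))).const_mul 4).exp) fun s hs => ?_
      obtain ⟨h1, h2, h3⟩ := hS s hs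
      have h4 := mul_nonneg (coflowK_lower_bound h2.le (hle s h1) (hZpos s (hT.trans h1)) h3.le)
        (Real.exp_pos (4 * X s)).le
      linarith
    have hlim : Tendsto (fun s => Z s * Real.exp (4 * X s)) atTop
        (𝓝 (0 * Real.exp (4 * (1 / 2)))) :=
      hZlim.mul (Real.continuous_exp.tendsto _ |>.comp (hXlim.const_mul 4))
    rw [zero_mul] at hlim
    have h0 : Z S * Real.exp (4 * X S) ≤ 0 := by
      refine ge_of_tendsto hlim ?_
      filter_upwards [eventually_ge_atTop S] with t ht
      exact hE self_mem_Ici ht ht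
    exact absurd (mul_pos (hZpos S (hT.trans hTS)) (Real.exp_pos _)) (not_lt.2 h0)
  · have h1 : (1 : ℝ) ≤ 1 / 2 := by
      refine ge_of_tendsto hXlim ?_
      filter_upwards [eventually_ge_atTop T] with s hs
      exact one_le_of_nonpos_of_nonpos (hXpos s (hT.trans hs)) (hZpos s (hT.trans hs))
        (hF s hs) (hK s hs)
    norm_num at h1

lemma exists_limits_of_constant_signs (hXpos : ∀ s, 0 ≤ s → 0 < X s)
    (hZpos : ∀ s, 0 ≤ s → 0 < Z s)
    (hX : ∀ s, 0 ≤ s → HasDerivAt X (4 * coflowF (X s) (Z s)) s)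
    (hZ : ∀ s, 0 ≤ s →
      HasDerivAt Z (4 * Z s * (Z s + 1) / X s * coflowK (X s) (Z s)) s)
    {T : ℝ} (hT : 0 ≤ T)
    (hF : (∀ s, T ≤ s → 0 ≤ coflowF (X s) (Z s)) ∨ (∀ s, T ≤ s → coflowF (X s) (Z s) ≤ 0))
    (hK : (∀ s, T ≤ s → 0 ≤ coflowK (X s) (Z s)) ∨ (∀ s, T ≤ s → coflowK (X s) (Z s) ≤ 0)) :
    ∃ x z, 0 < x ∧ Tendsto X atTop (𝓝 x) ∧ Tendsto Z atTop (𝓝 z) := by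
  have hX' := fun s (hs : T ≤ s) => hX s (hT.trans hs)
  have hZ' := fun s (hs : T ≤ s) => hZ s (hT.trans hs)
  have hcoef : ∀ s, T ≤ s → 0 ≤ 4 * Z s * (Z s + 1) / X s := fun s hs => by
    have := hXpos s (hT.trans hs)
    have := hZpos s (hT.trans hs)
    positivity
  obtain ⟨C, hC⟩ : ∃ C, ∀ s, T ≤ s → Z s ≤ C := by
    rcases hK with hK | hK
    · exact ⟨2, fun s hs => le_two_of_coflowK_nonneg (hK s hs)⟩
    · exact ⟨Z T, fun s hs => antitoneOn_Ici_of_hasDerivAt hZ'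
        (fun t ht => mul_nonpos_of_nonneg_of_nonpos (hcoef t ht) (hK t ht)) self_mem_Ici hs hs⟩
  obtain ⟨x, hx, hxlim⟩ : ∃ x, 0 < x ∧ Tendsto X atTop (𝓝 x) := by
    rcases hF with hF | hF
    · have hmono := monotoneOn_Ici_of_hasDerivAt hX'
        fun s hs => mul_nonneg zero_le_four (hF s hs)
      obtain ⟨x, hx⟩ := hmono.exists_tendsto_atTop fun s hs =>
        le_of_coflowF_nonneg (hZpos s (hT.trans hs)) (hC s hs) (hF s hs)
      refine ⟨x, (hXpos T hT).trans_le (ge_of_tendsto hx ?_), hx⟩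
      filter_upwards [eventually_ge_atTop T] with s hs
      exact hmono self_mem_Ici hs hs
    · have hhalf : ∀ s, T ≤ s → 1 / 2 ≤ X s := fun s hs =>
        (half_lt_of_coflowF_nonpos (hXpos s (hT.trans hs)) (hZpos s (hT.trans hs)) (hF s hs)).le
      obtain ⟨x, hx⟩ := (antitoneOn_Ici_of_hasDerivAt hX' fun s hs =>
        mul_nonpos_of_nonneg_of_nonpos zero_le_four (hF s hs)).exists_tendsto_atTop hhalf
      refine ⟨x, one_half_pos.trans_le (ge_of_tendsto hx ?_), hx⟩
      filter_upwards [eventually_ge_atTop T] with s hs using hhalf s hs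
  obtain ⟨z, hzlim⟩ : ∃ z, Tendsto Z atTop (𝓝 z) := by
    rcases hK with hK | hK
    · exact (monotoneOn_Ici_of_hasDerivAt hZ' fun s hs =>
        mul_nonneg (hcoef s hs) (hK s hs)).exists_tendsto_atTop hC
    · exact (antitoneOn_Ici_of_hasDerivAt hZ' fun s hs =>
        mul_nonpos_of_nonneg_of_nonpos (hcoef s hs) (hK s hs)).exists_tendsto_atTop
        fun s hs => (hZpos s (hT.trans hs)).le
  exact ⟨x, z, hx, hxlim, hzlim⟩

lemma coflow_tendsto_one (hXpos : ∀ s, 0 ≤ s → 0 < X s) (hZpos : ∀ s, 0 ≤ s → 0 < Z s)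
    (hX : ∀ s, 0 ≤ s → HasDerivAt X (4 * coflowF (X s) (Z s)) s)
    (hZ : ∀ s, 0 ≤ s →
      HasDerivAt Z (4 * Z s * (Z s + 1) / X s * coflowK (X s) (Z s)) s) :
    Tendsto X atTop (𝓝 1) ∧ Tendsto Z atTop (𝓝 1) := by
  obtain ⟨T, hT, hF, hK⟩ := eventually_constant_signs hXpos hZpos hX hZ
  obtain ⟨x, z, hx, hxlim, hzlim⟩ :=
    exists_limits_of_constant_signs hXpos hZpos hX hZ hT hF hK
  have hF0 : coflowF x z = 0 := by
    have := deriv_limit_eq_zero hX hxlim ((tendsto_coflowF hxlim hzlim).const_mul 4)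
    linarith
  have hK0 : 4 * z * (z + 1) / x * coflowK x z = 0 :=
    deriv_limit_eq_zero hZ hzlim
      ((((hzlim.const_mul 4).mul (hzlim.add_const 1)).div hxlim hx.ne').mul
        (tendsto_coflowK hxlim hzlim))
  have hz0 : 0 ≤ z := by
    refine ge_of_tendsto hzlim ?_
    filter_upwards [eventually_ge_atTop 0] with s hs using (hZpos s hs).le
  have hz : 0 < z := by
    refine hz0.lt_of_ne' fun hzero => ?_
    subst hzero
    rcases hK with hK | hK
    · have hmono := monotoneOn_Ici_of_hasDerivAt (fun s hs => hZ s (hT.trans hs)) fun s hs => by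
        have := hXpos s (hT.trans hs)
        have := hZpos s (hT.trans hs)
        exact mul_nonneg (by positivity) (hK s hs)
      refine absurd (hZpos T hT) (not_lt.2 (ge_of_tendsto hzlim ?_))
      filter_upwards [eventually_ge_atTop T] with s hs
      exact hmono self_mem_Ici hs hs
    · have hx2 : x = 1 / 2 := by
        have h1 : (x + 1) * (2 * x - 1) = 0 := by
          unfold coflowF at hF0
          linarith
        have h2 := (mul_eq_zero.1 h1).resolve_left (by positivity)
        linarith
      subst hx2
      exact not_tendsto_boundary_equilibrium hXpos hZpos hX hZ hT hF hK hxlim hzlim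
  obtain ⟨rfl, rfl⟩ := eq_one_of_coflow_eq_zero hx hz hF0
    ((mul_eq_zero.1 hK0).resolve_left (by positivity))
  exact ⟨hxlim, hzlim⟩

end Flow

theorem coflow_convergence_eps_neg (X Y : ℝ → ℝ)
    (hXdiff : Differentiable ℝ X) (hYdiff : Differentiable ℝ Y)
    (hXpos : ∀ s : ℝ, 0 ≤ s → 0 < X s) (hYpos : ∀ s : ℝ, 0 ≤ s → 0 < Y s)
    (hX : ∀ s : ℝ, 0 ≤ s → deriv X s = coflowP (-1) (X s) (Y s))
    (hY : ∀ s : ℝ, 0 ≤ s → deriv Y s = coflowQ (-1) (X s) (Y s)) :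
    Filter.Tendsto (fun s => (X s, Y s)) Filter.atTop
      (nhds ((1 : ℝ), (1 : ℝ))) := by
  have hX' : ∀ s, 0 ≤ s → HasDerivAt X (4 * coflowF (X s) (Y s / X s)) s := by
    intro s hs
    refine (hXdiff s).hasDerivAt.congr_deriv ?_
    have := (hXpos s hs).ne'
    rw [hX s hs, coflowP, coflowF]
    field_simp
    ring
  have hZ' : ∀ s, 0 ≤ s → HasDerivAt (fun s => Y s / X s)
      (4 * (Y s / X s) * (Y s / X s + 1) / X s * coflowK (X s) (Y s / X s)) s := by
    intro s hs
    have := (hXpos s hs).ne'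
    refine ((hYdiff s).hasDerivAt.div (hXdiff s).hasDerivAt this).congr_deriv ?_
    rw [hX s hs, hY s hs, coflowP, coflowQ, coflowK]
    field_simp
    ring
  obtain ⟨hXlim, hZlim⟩ := coflow_tendsto_one hXpos
    (fun s hs => div_pos (hYpos s hs) (hXpos s hs)) hX' hZ'
  refine hXlim.prodMk_nhds ?_
  have hmul := hZlim.mul hXlim
  rw [mul_one] at hmul
  refine hmul.congr' ?_
  filter_upwards [eventually_ge_atTop 0] with s hs
  exact div_mul_cancel₀ _ (hXpos s hs).ne'
end

section
/- For all real numbers X and Y with X ≥ 1 and Y > X, one has 2(1−X)Y² + (2X²−3X−1)Y + 2X(1−2X) < 0; consequently Q₁(X,Y) < 0, i.e. Y is strictly decreasing under the ε = 1 rescaled Laplacian coflow system in the region {(X,Y) : Y > X ≥ 1}. -/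
theorem coflow_Y_decreasing_eps_pos (X Y : ℝ) (hX : 1 ≤ X) (hY : X < Y) :
    2 * (1 - X) * Y ^ 2 + (2 * X ^ 2 - 3 * X - 1) * Y + 2 * X * (1 - 2 * X) < 0 ∧
      coflowQ 1 X Y < 0 := by
  have hXpos : 0 < X := by linarith
  have hYpos : 0 < Y := hXpos.trans hY
  have hneg : 2 * (1 - X) * Y ^ 2 + (2 * X ^ 2 - 3 * X - 1) * Y + 2 * X * (1 - 2 * X) < 0 := by
    have h₁ : 0 ≤ (X - 1) * Y * (Y - X) :=
      mul_nonneg (mul_nonneg (sub_nonneg.2 hX) hYpos.le) (sub_nonneg.2 hY.le)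
    have h₂ : 0 < (X + 1) * Y := by positivity
    have h₃ : 0 < X * (2 * X - 1) := mul_pos hXpos (by linarith)
    linarith
  refine ⟨hneg, ?_⟩
  unfold coflowQ
  rw [one_mul]
  exact mul_neg_of_pos_of_neg (by positivity) hneg
end

section
/- There exists a real number X̄ with 1 < X̄ < 2 such that for all real X ≥ X̄ and all real Y > 0, one has 2(1−X)Y² − (2X²−3X−1)Y + 2X(1−2X) ≤ 0; consequently Q₋₁(X,Y) ≤ 0 whenever X ≥ X̄ and Y > 0, i.e. Y is non-increasing under the ε = −1 rescaled Laplacian coflow system in the region {X ≥ X̄}. -/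
theorem coflow_Y_nonincreasing_eps_neg :
    ∃ Xbar : ℝ, 1 < Xbar ∧ Xbar < 2 ∧
      ∀ X Y : ℝ, Xbar ≤ X → 0 < Y →
        2 * (1 - X) * Y ^ 2 - (2 * X ^ 2 - 3 * X - 1) * Y + 2 * X * (1 - 2 * X) ≤ 0 ∧
          coflowQ (-1) X Y ≤ 0 := by
  refine ⟨9 / 5, by norm_num, by norm_num, fun X Y hX hY => ?_⟩
  have hlin : 0 ≤ 2 * X ^ 2 - 3 * X - 1 := by nlinarith
  have hquad : 2 * (1 - X) * Y ^ 2 ≤ 0 :=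
    mul_nonpos_of_nonpos_of_nonneg (by linarith) (sq_nonneg Y)
  have hmid : 0 ≤ (2 * X ^ 2 - 3 * X - 1) * Y := mul_nonneg hlin hY.le
  have hconst : 2 * X * (1 - 2 * X) ≤ 0 :=
    mul_nonpos_of_nonneg_of_nonpos (by linarith) (by linarith)
  refine ⟨by linarith, ?_⟩
  exact mul_nonpos_of_nonneg_of_nonpos (by positivity) (by linarith)
end

section
/- The Fréchet derivative at the point (1/5, 1/5) of the map (X,Y) ↦ (−P₁(X,Y), −Q₁(X,Y)), defined on the open set {(X,Y) ∈ ℝ² : X > 0}, has eigenvalues exactly 64/5 and 20; in particular both eigenvalues are positive, so (1/5, 1/5) is an unstable source for the ε = 1 rescaled Laplacian flow system. -/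
/-- At a zero of `g`, the derivative of the product `f * g` is `f x • g'`. -/
theorem HasFDerivAt.fun_mul_of_eq_zero_right {E : Type*} [NormedAddCommGroup E] [NormedSpace ℝ E]
    {f g : E → ℝ} {g' : E →L[ℝ] ℝ} {x : E} (hf : DifferentiableAt ℝ f x)
    (hg : HasFDerivAt g g' x) (hx : g x = 0) :
    HasFDerivAt (fun y => f y * g y) (f x • g') x := by
  simpa [hx] using hf.hasFDerivAt.fun_mul hg

open ContinuousLinearMap in
theorem hasFDerivAt_coflowP_one :
    HasFDerivAt (fun p : ℝ × ℝ => coflowP 1 p.1 p.2)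
      (-(76 / 5 : ℝ) • fst ℝ ℝ ℝ - (24 / 5 : ℝ) • snd ℝ ℝ ℝ) (1 / 5, 1 / 5) := by
  have hX : HasFDerivAt (fun p : ℝ × ℝ => p.1) (fst ℝ ℝ ℝ) (1 / 5, 1 / 5) := hasFDerivAt_fst
  have hY : HasFDerivAt (fun p : ℝ × ℝ => p.2) (snd ℝ ℝ ℝ) (1 / 5, 1 / 5) := hasFDerivAt_snd
  have hX2 := hX.pow 2
  have hY2 := hY.pow 2
  have hf : DifferentiableAt ℝ (fun p : ℝ × ℝ => 4 / p.1 ^ 2) (1 / 5, 1 / 5) := by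
    fun_prop (disch := norm_num)
  have hg := (((hX.add_const 1).fun_mul hY2).fun_add
    (((((((hX2.const_mul 2).fun_sub (hX.const_mul 2)).sub_const 1).const_mul
      (2 * 1)).fun_mul hX).fun_mul hY))).fun_sub
    (((hX2.const_mul 2).fun_mul ((hX.const_mul 2).sub_const 1)).fun_mul
      (hX.add_const 1))
  refine (HasFDerivAt.fun_mul_of_eq_zero_right hf hg (by norm_num)).congr_fderiv ?_
  ext <;> norm_num

open ContinuousLinearMap in
theorem hasFDerivAt_coflowQ_one :
    HasFDerivAt (fun p : ℝ × ℝ => coflowQ 1 p.1 p.2)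
      (-(12 / 5 : ℝ) • fst ℝ ℝ ℝ - (88 / 5 : ℝ) • snd ℝ ℝ ℝ) (1 / 5, 1 / 5) := by
  have hX : HasFDerivAt (fun p : ℝ × ℝ => p.1) (fst ℝ ℝ ℝ) (1 / 5, 1 / 5) := hasFDerivAt_fst
  have hY : HasFDerivAt (fun p : ℝ × ℝ => p.2) (snd ℝ ℝ ℝ) (1 / 5, 1 / 5) := hasFDerivAt_snd
  have hX2 := hX.pow 2
  have hY2 := hY.pow 2
  have hf : DifferentiableAt ℝ (fun p : ℝ × ℝ => 4 * p.2 / p.1 ^ 2) (1 / 5, 1 / 5) := by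
    fun_prop (disch := norm_num)
  have hg := ((((hX.const_sub 1).const_mul 2).fun_mul hY2).fun_add
    (((((hX2.const_mul 2).fun_sub (hX.const_mul 3)).sub_const 1).const_mul 1).fun_mul
      hY)).fun_add ((hX.const_mul 2).fun_mul ((hX.const_mul 2).const_sub 1))
  refine (HasFDerivAt.fun_mul_of_eq_zero_right hf hg (by norm_num)).congr_fderiv ?_
  ext <;> norm_num

theorem flow_linearization_eps_pos :
    ∀ μ : ℝ,
      Module.End.HasEigenvalue
        ((fderiv ℝ (fun p : ℝ × ℝ => (-coflowP 1 p.1 p.2, -coflowQ 1 p.1 p.2))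
            (1 / 5, 1 / 5)).toLinearMap) μ
        ↔ μ = 64 / 5 ∨ μ = 20 := by
  intro μ
  rw [(hasFDerivAt_coflowP_one.fun_neg.prodMk hasFDerivAt_coflowQ_one.fun_neg).fderiv]
  constructor
  · intro h
    obtain ⟨⟨a, b⟩, hv⟩ := h.exists_hasEigenvector
    have happ := hv.apply_eq_smul
    simp only [ContinuousLinearMap.coe_coe, ContinuousLinearMap.prod_apply, neg_apply,
      sub_apply, smul_apply,
      ContinuousLinearMap.coe_fst', ContinuousLinearMap.coe_snd', smul_eq_mul, Prod.smul_mk,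
      Prod.mk.injEq] at happ
    obtain ⟨h₁, h₂⟩ := happ
    have ha : (μ - 64 / 5) * (μ - 20) * a = 0 := by
      linear_combination (88 / 5 - μ) * h₁ - 24 / 5 * h₂
    have hb : (μ - 64 / 5) * (μ - 20) * b = 0 := by
      linear_combination (76 / 5 - μ) * h₂ - 12 / 5 * h₁
    by_contra! hμ
    have hchar : (μ - 64 / 5) * (μ - 20) ≠ 0 :=
      mul_ne_zero (sub_ne_zero.2 hμ.1) (sub_ne_zero.2 hμ.2)
    exact hv.2 (Prod.ext ((mul_eq_zero.1 ha).resolve_left hchar)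
      ((mul_eq_zero.1 hb).resolve_left hchar))
  · rintro (rfl | rfl)
    · refine Module.End.hasEigenvalue_of_hasEigenvector (x := ((-2, 1) : ℝ × ℝ))
        (Module.End.hasEigenvector_iff.2 ⟨Module.End.mem_eigenspace_iff.2 ?_, by simp⟩)
      ext <;> norm_num
    · refine Module.End.hasEigenvalue_of_hasEigenvector (x := ((1, 1) : ℝ × ℝ))
        (Module.End.hasEigenvector_iff.2 ⟨Module.End.mem_eigenspace_iff.2 ?_, by simp⟩)
      ext <;> norm_num
end

section
/- The Fréchet derivative at the point (1, 1) of the map (X,Y) ↦ (−P₋₁(X,Y), −Q₋₁(X,Y)), defined on the open set {(X,Y) ∈ ℝ² : X > 0}, has eigenvalues exactly 4 and 64; in particular both eigenvalues are positive, so (1, 1) is an unstable source for the ε = −1 rescaled Laplacian flow system. -/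
/-- The Jacobian `(76, -24; 36, -8)` of the flow at the nearly parallel point. -/
noncomputable def flowJacobian : ℝ × ℝ →L[ℝ] ℝ × ℝ :=
  ((76 : ℝ) • ContinuousLinearMap.fst ℝ ℝ ℝ - (24 : ℝ) • ContinuousLinearMap.snd ℝ ℝ ℝ).prod
    ((36 : ℝ) • ContinuousLinearMap.fst ℝ ℝ ℝ - (8 : ℝ) • ContinuousLinearMap.snd ℝ ℝ ℝ)

theorem flowJacobian_apply (v : ℝ × ℝ) :
    flowJacobian v = (76 * v.1 - 24 * v.2, 36 * v.1 - 8 * v.2) := by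
  simp [flowJacobian]

theorem hasFDerivAt_flow_eps_neg :
    HasFDerivAt (fun p : ℝ × ℝ => (-coflowP (-1) p.1 p.2, -coflowQ (-1) p.1 p.2))
      flowJacobian (1, 1) := by
  have hX : HasFDerivAt (fun p : ℝ × ℝ => p.1) (ContinuousLinearMap.fst ℝ ℝ ℝ) (1, 1) :=
    hasFDerivAt_fst
  have hY : HasFDerivAt (fun p : ℝ × ℝ => p.2) (ContinuousLinearMap.snd ℝ ℝ ℝ) (1, 1) :=
    hasFDerivAt_snd
  have hI : HasFDerivAt (fun p : ℝ × ℝ => (p.1 ^ 2)⁻¹)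
      ((-2 : ℝ) • ContinuousLinearMap.fst ℝ ℝ ℝ) (1, 1) := by
    have h := (hasDerivAt_inv (x := ((1, 1) : ℝ × ℝ).1 ^ 2) (by norm_num)).comp_hasFDerivAt
      ((1, 1) : ℝ × ℝ) (hX.pow 2)
    refine h.congr_fderiv (ContinuousLinearMap.ext fun v => ?_)
    simp
  have hP := (((hI.const_mul 4).mul
    ((((hX.add_const 1).mul (hY.pow 2)).add
      ((((((hX.pow 2).const_mul 2).sub (hX.const_mul 2)).sub_const 1).const_mul
        (2 * (-1 : ℝ))).mul hX |>.mul hY)).sub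
      ((((hX.pow 2).const_mul 2).mul ((hX.const_mul 2).sub_const 1)).mul (hX.add_const 1)))).neg)
  have hQ := ((((hY.const_mul 4).mul hI).mul
    (((((hX.const_sub 1).const_mul 2).mul (hY.pow 2)).add
      (((((hX.pow 2).const_mul 2).sub (hX.const_mul 3)).sub_const 1).const_mul (-1 : ℝ) |>.mul
        hY)).add ((hX.const_mul 2).mul ((hX.const_mul 2).const_sub 1)))).neg)
  refine ((hP.prodMk hQ).congr_of_eventuallyEq (.of_forall fun p => ?_)).congr_fderiv
    (ContinuousLinearMap.ext fun v => ?_)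
  · simp [coflowP, coflowQ, div_eq_mul_inv]
  · rw [flowJacobian_apply]
    ext <;> simp <;> ring

theorem flow_linearization_eps_neg :
    ∀ μ : ℝ,
      Module.End.HasEigenvalue
        ((fderiv ℝ (fun p : ℝ × ℝ => (-coflowP (-1) p.1 p.2, -coflowQ (-1) p.1 p.2))
            (1, 1)).toLinearMap) μ
        ↔ μ = 4 ∨ μ = 64 := by
  intro μ
  rw [hasFDerivAt_flow_eps_neg.fderiv]
  constructor
  · intro h
    obtain ⟨v, hv⟩ := h.exists_hasEigenvector
    have hJ := hv.apply_eq_smul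
    rw [ContinuousLinearMap.coe_coe, flowJacobian_apply, Prod.ext_iff] at hJ
    obtain ⟨h₁, h₂⟩ := hJ
    simp only [Prod.smul_fst, Prod.smul_snd, smul_eq_mul] at h₁ h₂
    by_contra hμ
    have hχ : (μ - 4) * (μ - 64) ≠ 0 := by
      push Not at hμ
      exact mul_ne_zero (sub_ne_zero.2 hμ.1) (sub_ne_zero.2 hμ.2)
    refine hv.2 (Prod.ext ?_ ?_)
    · refine (mul_eq_zero.1 ?_).resolve_left hχ
      linear_combination (-μ - 8) * h₁ + 24 * h₂
    · refine (mul_eq_zero.1 ?_).resolve_left hχ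
      linear_combination (-36) * h₁ + (76 - μ) * h₂
  · rintro (rfl | rfl)
    · refine Module.End.hasEigenvalue_of_hasEigenvector (x := (1, 3))
        ⟨Module.End.mem_eigenspace_iff.2 ?_, by simp⟩
      rw [ContinuousLinearMap.coe_coe, flowJacobian_apply]
      ext <;> norm_num
    · refine Module.End.hasEigenvalue_of_hasEigenvector (x := (2, 1))
        ⟨Module.End.mem_eigenspace_iff.2 ?_, by simp⟩
      rw [ContinuousLinearMap.coe_coe, flowJacobian_apply]
      ext <;> norm_num
end

section
/- For all real numbers A > 0 and B > 0, one has W₁(A,B) = 0 and W₂(A,B) = 0 if and only if (A,B) = (1/5, 1/5) or (A,B) = (1, 1). (In other words, these two points are the only critical points in the open positive quadrant of the rescaled Ricci flow system.) -/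
/-- Right-hand side `W₁(A,B)` of the rescaled Ricci flow equation for `A`. -/
noncomputable def ricciW1 (A B : ℝ) : ℝ :=
  (4 * (1 - A) / A) * (B * (1 + A) - 2 * A * (1 - 2 * A))

/-- Right-hand side `W₂(A,B)` of the rescaled Ricci flow equation for `B`. -/
noncomputable def ricciW2 (A B : ℝ) : ℝ :=
  (4 * B / A ^ 2) * (2 * A ^ 2 * (3 - A) - B * (1 + 3 * A ^ 2))

theorem ricci_critical_points (A B : ℝ) (hA : 0 < A) (hB : 0 < B) :
    (ricciW1 A B = 0 ∧ ricciW2 A B = 0) ↔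
      ((A = 1 / 5 ∧ B = 1 / 5) ∨ (A = 1 ∧ B = 1)) := by
  unfold ricciW1 ricciW2
  constructor
  · rintro ⟨h₁, h₂⟩
    have hW₂ : 2 * A ^ 2 * (3 - A) - B * (1 + 3 * A ^ 2) = 0 :=
      (mul_eq_zero.mp h₂).resolve_left (by positivity)
    rcases mul_eq_zero.mp h₁ with h | hW₁
    · have hA1 : A = 1 := by
        rcases div_eq_zero_iff.mp h with h | h <;> linarith
      subst hA1
      exact Or.inr ⟨rfl, by linarith⟩
    · have hprod : (2 * A * (1 + A ^ 2)) * (1 - 5 * A) = 0 := by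
        linear_combination -(1 + 3 * A ^ 2) * hW₁ - (1 + A) * hW₂
      have hA5 : A = 1 / 5 := by
        linarith [(mul_eq_zero.mp hprod).resolve_left (by positivity)]
      subst hA5
      exact Or.inl ⟨rfl, by linarith⟩
  · rintro (⟨rfl, rfl⟩ | ⟨rfl, rfl⟩) <;> norm_num
end

section
/- The Fréchet derivative at the point (1, 1) of the map (A,B) ↦ (W₁(A,B), W₂(A,B)), defined on the open set {(A,B) ∈ ℝ² : A > 0}, equals −16 times the identity map of ℝ²; in particular both of its eigenvalues equal −16, so the 3-Sasakian critical point (1, 1) is linearly stable for the rescaled Ricci flow system. -/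
/-- Derivative of `W₁` at `(1, 1)`. -/
theorem hasFDerivAt_ricciW1 :
    HasFDerivAt (fun p : ℝ × ℝ => ricciW1 p.1 p.2)
      ((-16 : ℝ) • ContinuousLinearMap.fst ℝ ℝ ℝ) (1, 1) := by
  have hA : HasFDerivAt (fun p : ℝ × ℝ => p.1) (ContinuousLinearMap.fst ℝ ℝ ℝ) (1, 1) :=
    hasFDerivAt_fst
  have hB : HasFDerivAt (fun p : ℝ × ℝ => p.2) (ContinuousLinearMap.snd ℝ ℝ ℝ) (1, 1) :=
    hasFDerivAt_snd
  have h := (((hA.const_sub 1).const_mul 4).mul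
    ((hasDerivAt_inv one_ne_zero).comp_hasFDerivAt ((1, 1) : ℝ × ℝ) hA)).mul
    ((hB.mul (hA.const_add 1)).sub ((hA.const_mul 2).mul ((hA.const_mul 2).const_sub 1)))
  refine h.congr_fderiv ?_
  ext <;> norm_num

/-- Derivative of `W₂` at `(1, 1)`. -/
theorem hasFDerivAt_ricciW2 :
    HasFDerivAt (fun p : ℝ × ℝ => ricciW2 p.1 p.2)
      ((-16 : ℝ) • ContinuousLinearMap.snd ℝ ℝ ℝ) (1, 1) := by
  have hA : HasFDerivAt (fun p : ℝ × ℝ => p.1) (ContinuousLinearMap.fst ℝ ℝ ℝ) (1, 1) :=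
    hasFDerivAt_fst
  have hB : HasFDerivAt (fun p : ℝ × ℝ => p.2) (ContinuousLinearMap.snd ℝ ℝ ℝ) (1, 1) :=
    hasFDerivAt_snd
  have hA2 := hA.pow 2
  have h := ((hB.const_mul 4).mul
    ((hasDerivAt_inv (by norm_num)).comp_hasFDerivAt ((1, 1) : ℝ × ℝ) hA2)).mul
    (((hA2.const_mul 2).mul (hA.const_sub 3)).sub (hB.mul ((hA2.const_mul 3).const_add 1)))
  refine h.congr_fderiv ?_
  ext <;> norm_num

/-- The only eigenvalue of a scalar multiple of the identity is the scalar. -/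
theorem hasEigenvalue_smul_id_iff {K V : Type*} [Field K] [AddCommGroup V] [Module K V]
    [Nontrivial V] (c μ : K) :
    Module.End.HasEigenvalue (c • (LinearMap.id : V →ₗ[K] V)) μ ↔ μ = c := by
  constructor
  · intro h
    obtain ⟨v, hv⟩ := h.exists_hasEigenvector
    have hcv : c • v = μ • v := by simpa using hv.apply_eq_smul
    exact (smul_left_injective K hv.2 hcv).symm
  · rintro rfl
    obtain ⟨v, hv⟩ := exists_ne (0 : V)
    exact Module.End.hasEigenvalue_of_hasEigenvector
      ⟨Module.End.mem_eigenspace_iff.mpr (by simp), hv⟩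

theorem ricci_linearization_sasakian :
    (fderiv ℝ (fun p : ℝ × ℝ => (ricciW1 p.1 p.2, ricciW2 p.1 p.2)) (1, 1)
        = (-16 : ℝ) • ContinuousLinearMap.id ℝ (ℝ × ℝ)) ∧
      (∀ μ : ℝ,
        Module.End.HasEigenvalue
          ((fderiv ℝ (fun p : ℝ × ℝ => (ricciW1 p.1 p.2, ricciW2 p.1 p.2))
              (1, 1)).toLinearMap) μ
          ↔ μ = -16) := by
  have h : fderiv ℝ (fun p : ℝ × ℝ => (ricciW1 p.1 p.2, ricciW2 p.1 p.2)) (1, 1)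
      = (-16 : ℝ) • ContinuousLinearMap.id ℝ (ℝ × ℝ) := by
    rw [(hasFDerivAt_ricciW1.prodMk hasFDerivAt_ricciW2).fderiv]
    ext <;> simp
  refine ⟨h, fun μ => ?_⟩
  rw [h]
  exact hasEigenvalue_smul_id_iff (V := ℝ × ℝ) (-16 : ℝ) μ
end

section
/- The Fréchet derivative at the point (1/5, 1/5) of the map (A,B) ↦ (W₁(A,B), W₂(A,B)), defined on the open set {(A,B) ∈ ℝ² : A > 0}, is the linear endomorphism of ℝ² given in the standard basis by the matrix [[−16/5, 96/5], [192/5, −112/5]], and its eigenvalues are exactly 16 and −208/5; in particular it has one positive and one negative eigenvalue, so the squashed Einstein critical point (1/5, 1/5) is a saddle point (and hence unstable) for the rescaled Ricci flow system. -/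
/-- At a zero of `g`, the derivative of the product `f * g` is `f p` times that of `g`. -/
theorem hasFDerivAt_mul_of_eq_zero {f g : ℝ × ℝ → ℝ} {g' : ℝ × ℝ →L[ℝ] ℝ} {p : ℝ × ℝ}
    (hf : DifferentiableAt ℝ f p) (hg : HasFDerivAt g g' p) (h0 : g p = 0) :
    HasFDerivAt (fun q => f q * g q) (f p • g') p := by
  simpa [h0] using hf.hasFDerivAt.fun_mul hg

theorem fderiv_ricci_squashed (v : ℝ × ℝ) :
    fderiv ℝ (fun p : ℝ × ℝ => (ricciW1 p.1 p.2, ricciW2 p.1 p.2)) (1 / 5, 1 / 5) v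
      = (-(16 / 5) * v.1 + (96 / 5) * v.2, (192 / 5) * v.1 + -(112 / 5) * v.2) := by
  have hA : HasFDerivAt (fun p : ℝ × ℝ => p.1) (ContinuousLinearMap.fst ℝ ℝ ℝ)
    ((1 / 5, 1 / 5) : ℝ × ℝ) := hasFDerivAt_fst
  have hB : HasFDerivAt (fun p : ℝ × ℝ => p.2) (ContinuousLinearMap.snd ℝ ℝ ℝ)
    ((1 / 5, 1 / 5) : ℝ × ℝ) := hasFDerivAt_snd
  have hf₁ : DifferentiableAt ℝ (fun p : ℝ × ℝ => 4 * (1 - p.1) / p.1) (1 / 5, 1 / 5) := by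
    fun_prop (disch := norm_num)
  have hf₂ : DifferentiableAt ℝ (fun p : ℝ × ℝ => 4 * p.2 / p.1 ^ 2) (1 / 5, 1 / 5) := by
    fun_prop (disch := norm_num)
  have h₁ := hasFDerivAt_mul_of_eq_zero hf₁
    ((hB.fun_mul (hA.const_add 1)).fun_sub
      ((hA.const_mul 2).fun_mul ((hA.const_mul 2).const_sub 1))) (by norm_num)
  have h₂ := hasFDerivAt_mul_of_eq_zero hf₂
    ((((hA.pow 2).const_mul 2).fun_mul (hA.const_sub 3)).fun_sub
      (hB.fun_mul (((hA.pow 2).const_mul 3).const_add 1))) (by norm_num)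
  have h : HasFDerivAt (fun p : ℝ × ℝ => (ricciW1 p.1 p.2, ricciW2 p.1 p.2)) _
    (1 / 5, 1 / 5) := h₁.prodMk h₂
  rw [h.fderiv]
  ext
  · simp
    ring
  · simp
    ring

theorem ricci_linearization_squashed :
    (∀ v : ℝ × ℝ,
        fderiv ℝ (fun p : ℝ × ℝ => (ricciW1 p.1 p.2, ricciW2 p.1 p.2))
          (1 / 5, 1 / 5) v
          = (-(16 / 5) * v.1 + (96 / 5) * v.2, (192 / 5) * v.1 + -(112 / 5) * v.2)) ∧
    (∀ μ : ℝ,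
        Module.End.HasEigenvalue
          ((fderiv ℝ (fun p : ℝ × ℝ => (ricciW1 p.1 p.2, ricciW2 p.1 p.2))
              (1 / 5, 1 / 5)).toLinearMap) μ
          ↔ μ = 16 ∨ μ = -(208 / 5)) := by
  refine ⟨fderiv_ricci_squashed, fun μ => ⟨fun h => ?_, fun h => ?_⟩⟩
  · obtain ⟨⟨x, y⟩, hv⟩ := h.exists_hasEigenvector
    have he := hv.apply_eq_smul
    rw [ContinuousLinearMap.coe_coe, fderiv_ricci_squashed, Prod.smul_mk, Prod.mk.injEq] at he
    obtain ⟨h₁, h₂⟩ := he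
    simp only [smul_eq_mul] at h₁ h₂
    have hx : (μ - 16) * (μ + 208 / 5) * x = 0 := by
      linear_combination (-(μ + 112 / 5)) * h₁ - 96 / 5 * h₂
    have hy : (μ - 16) * (μ + 208 / 5) * y = 0 := by
      linear_combination (-(μ + 16 / 5)) * h₂ - 192 / 5 * h₁
    have hμ : (μ - 16) * (μ + 208 / 5) = 0 := by
      by_contra hne
      exact hv.2 (Prod.ext ((mul_eq_zero.1 hx).resolve_left hne)
        ((mul_eq_zero.1 hy).resolve_left hne))
    rcases mul_eq_zero.1 hμ with h | h
    · exact Or.inl (by linarith)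
    · exact Or.inr (by linarith)
  · have key : ∀ y : ℝ, (-(16 / 5) + 96 / 5 * y = μ) → (192 / 5 + -(112 / 5) * y = μ * y) →
        Module.End.HasEigenvalue
          ((fderiv ℝ (fun p : ℝ × ℝ => (ricciW1 p.1 p.2, ricciW2 p.1 p.2))
              (1 / 5, 1 / 5)).toLinearMap) μ := by
      intro y h₁ h₂
      refine Module.End.hasEigenvalue_of_hasEigenvector (x := ((1, y) : ℝ × ℝ))
        ⟨Module.End.mem_eigenspace_iff.2 ?_, by simp⟩
      rw [ContinuousLinearMap.coe_coe, fderiv_ricci_squashed, Prod.smul_mk, Prod.mk.injEq]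
      simp only [smul_eq_mul, mul_one]
      exact ⟨h₁, h₂⟩
    rcases h with rfl | rfl
    · exact key 1 (by norm_num) (by norm_num)
    · exact key (-2) (by norm_num) (by norm_num)
end

section
/- Let A, B : ℝ → ℝ be differentiable functions with A(s) > 0 and B(s) > 0 for all s ≥ 0, satisfying A′(s) = W₁(A(s), B(s)) and B′(s) = W₂(A(s), B(s)) for all s ≥ 0. If A(0) > 1/5 and B(0)(1 + A(0)) > 2A(0)(1 − 2A(0)), then (A(s), B(s)) converges to (1, 1) as s → ∞. -/
open Filter Topology Set

/-- A function that is nondecreasing while below a level it starts above stays above the level. -/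
lemma le_of_deriv_nonneg_below {f : ℝ → ℝ} (hf : Differentiable ℝ f) {t₀ t m : ℝ}
    (ht : t₀ ≤ t) (h₀ : m ≤ f t₀)
    (h : ∀ s ∈ Ioo t₀ t, f s < m → 0 ≤ deriv f s) : m ≤ f t := by
  by_contra! hlt
  have hcomp : IsCompact (Icc t₀ t ∩ {s | m ≤ f s}) :=
    isCompact_Icc.inter_right (isClosed_le continuous_const hf.continuous)
  obtain ⟨τ, ⟨⟨hτ₀, hτt⟩, hτ⟩, hmax⟩ := hcomp.exists_isGreatest ⟨t₀, ⟨le_rfl, ht⟩, h₀⟩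
  have hbelow : ∀ s ∈ Ioo τ t, f s < m := by
    intro s hs
    by_contra! hge
    exact absurd (hmax ⟨⟨hτ₀.trans hs.1.le, hs.2.le⟩, hge⟩) (not_le.2 hs.1)
  have hmono : MonotoneOn f (Icc τ t) := by
    refine monotoneOn_of_deriv_nonneg (convex_Icc τ t) hf.continuous.continuousOn
      hf.differentiableOn ?_
    rw [interior_Icc]
    exact fun s hs => h s ⟨hτ₀.trans_lt hs.1, hs.2⟩ (hbelow s hs)
  have hle := hmono (left_mem_Icc.2 hτt) (right_mem_Icc.2 hτt) hτt
  have hτ' : m ≤ f τ := hτ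
  linarith

/-- A function that is nonincreasing while above a level it starts below stays below the level. -/
lemma le_of_deriv_nonpos_above {f : ℝ → ℝ} (hf : Differentiable ℝ f) {t₀ t m : ℝ}
    (ht : t₀ ≤ t) (h₀ : f t₀ ≤ m)
    (h : ∀ s ∈ Ioo t₀ t, m < f s → deriv f s ≤ 0) : f t ≤ m := by
  have key := le_of_deriv_nonneg_below hf.neg ht (m := -m) (by simpa using h₀) (by
    intro s hs hlt
    rw [deriv.neg]
    have := h s hs (by simpa using hlt)
    linarith)
  simpa using key

/-- A function growing at a uniform positive rate while below a level is eventually above it. -/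
lemma eventually_ge_of_le_deriv_below {f : ℝ → ℝ} (hf : Differentiable ℝ f) {m c : ℝ}
    (hc : 0 < c) (h : ∀ᶠ s in atTop, f s < m → c ≤ deriv f s) : ∀ᶠ s in atTop, m ≤ f s := by
  obtain ⟨T, hT⟩ := eventually_atTop.1 h
  have hex : ∃ t ≥ T, m ≤ f t := by
    by_contra! hlt
    set t := T + (m - f T) / c
    have hpos : 0 < (m - f T) / c := div_pos (by linarith [hlt T le_rfl]) hc
    have hTt : T ≤ t := by simp only [t]; linarith
    have hgrow := (convex_Icc T t).mul_sub_le_image_sub_of_le_deriv (C := c)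
      hf.continuous.continuousOn hf.differentiableOn
      (fun s hs => by
        rw [interior_Icc] at hs
        exact hT s hs.1.le (hlt s hs.1.le))
      T (left_mem_Icc.2 hTt) t (right_mem_Icc.2 hTt) hTt
    have hval : c * (t - T) = m - f T := by
      simp only [t]
      field_simp
      ring
    linarith [hlt t hTt]
  obtain ⟨t, htT, ht⟩ := hex
  filter_upwards [eventually_ge_atTop t] with s hs
  exact le_of_deriv_nonneg_below hf hs ht
    fun r hr hlt => hc.le.trans (hT r (htT.trans hr.1.le) hlt)

/-- A function decaying at a uniform positive rate while above a level is eventually below it. -/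
lemma eventually_le_of_deriv_le_above {f : ℝ → ℝ} (hf : Differentiable ℝ f) {m c : ℝ}
    (hc : 0 < c) (h : ∀ᶠ s in atTop, m < f s → deriv f s ≤ -c) : ∀ᶠ s in atTop, f s ≤ m := by
  have key := eventually_ge_of_le_deriv_below hf.neg (m := -m) hc (by
    filter_upwards [h] with s hs hlt
    rw [deriv.neg]
    have := hs (by simpa using hlt)
    linarith)
  filter_upwards [key] with s hs
  simpa using hs

/-- If positivity of a continuous function before any time forces a uniform positive lower bound at
that time, then the bound holds at all times. -/
lemma forall_ge_of_forall_pos_before {f : ℝ → ℝ} (hf : Continuous f) {p : ℝ} (hp : 0 < p)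
    (h : ∀ t, 0 ≤ t → (∀ s ∈ Ico 0 t, 0 < f s) → p ≤ f t) {t : ℝ} (ht : 0 ≤ t) : p ≤ f t := by
  refine h t ht ?_
  by_contra! hneg
  obtain ⟨r, hr, hfr⟩ := hneg
  have hcomp : IsCompact (Icc 0 r ∩ {s | f s ≤ 0}) :=
    isCompact_Icc.inter_right (isClosed_le hf continuous_const)
  obtain ⟨τ, ⟨⟨hτ₀, hτr⟩, hτ⟩, hmin⟩ := hcomp.exists_isLeast ⟨r, ⟨hr.1, le_rfl⟩, hfr⟩
  have hτ' : f τ ≤ 0 := hτ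
  have := h τ hτ₀ fun s hs => by
    by_contra! hle
    exact absurd (hmin ⟨⟨hs.1, hs.2.le.trans hτr⟩, hle⟩) (not_le.2 hs.2)
  linarith

/-- The defining expression of the curve `γ_A`, positive to the right of the curve. -/
def gammaExpr (A B : ℝ) : ℝ := B * (1 + A) - 2 * A * (1 - 2 * A)

lemma ricciW1_nonneg {A B : ℝ} (hA : 0 < A) (hA1 : A ≤ 1) (hP : 0 ≤ gammaExpr A B) :
    0 ≤ ricciW1 A B :=
  mul_nonneg (div_nonneg (by linarith) hA.le) hP

lemma ricciW1_nonpos {A B : ℝ} (hA1 : 1 ≤ A) (hP : 0 ≤ gammaExpr A B) :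
    ricciW1 A B ≤ 0 :=
  mul_nonpos_of_nonpos_of_nonneg
    (div_nonpos_of_nonpos_of_nonneg (by linarith) (by linarith)) hP

lemma ricciW2_nonneg {A B : ℝ} (hB : 0 < B)
    (hQ : 0 ≤ 2 * A ^ 2 * (3 - A) - B * (1 + 3 * A ^ 2)) : 0 ≤ ricciW2 A B :=
  mul_nonneg (by positivity) hQ

lemma ricciW2_nonpos {A B : ℝ} (hB : 0 < B)
    (hQ : 2 * A ^ 2 * (3 - A) - B * (1 + 3 * A ^ 2) ≤ 0) : ricciW2 A B ≤ 0 :=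
  mul_nonpos_of_nonneg_of_nonpos (by positivity) hQ

/-- The derivative of `gammaExpr` along the flow, as a linear expression in `gammaExpr A B` and
`5 * A - 1`. -/
lemma gammaExpr_deriv_eq {A B : ℝ} (hA : 0 < A) :
    ricciW2 A B * (1 + A) + ricciW1 A B * (B - 2 + 8 * A) =
      (-(4 * B / A ^ 2 * (1 + 3 * A ^ 2)) + 4 * (1 - A) / A * (B - 2 + 8 * A)) * gammaExpr A B
        + 8 * B / A * (5 * A - 1) * (1 + A ^ 2) := by
  unfold ricciW1 ricciW2 gammaExpr
  field_simp
  ring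

lemma gammaExpr_deriv_lower_bound {A B a b M : ℝ} (ha : 1 / 5 < a) (haA : a ≤ A) (hA1 : A ≤ 1)
    (hb : 0 < b) (hbB : b ≤ B) (hBM : B ≤ M) (hP : 0 ≤ gammaExpr A B) :
    8 * b * (5 * a - 1) - (16 * M / a ^ 2 + 8 / a) * gammaExpr A B ≤
      ricciW2 A B * (1 + A) + ricciW1 A B * (B - 2 + 8 * A) := by
  have ha0 : 0 < a := by linarith
  have hA0 : 0 < A := by linarith
  have hB0 : 0 < B := by linarith
  rw [gammaExpr_deriv_eq hA0]
  have h1 : 4 * B / A ^ 2 * (1 + 3 * A ^ 2) ≤ 4 * M / a ^ 2 * 4 := by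
    have : A ^ 2 ≤ 1 := by nlinarith
    have h4 : 1 + 3 * A ^ 2 ≤ 4 := by linarith
    have hM : 0 < M := by linarith
    gcongr
  have h2 : -(8 / a) ≤ 4 * (1 - A) / A * (B - 2 + 8 * A) := by
    have h3 : 4 * (1 - A) / A ≤ 4 / a := by
      have : 4 * (1 - A) ≤ 4 := by linarith
      gcongr
    have h4 : 0 ≤ 4 * (1 - A) / A := div_nonneg (by linarith) hA0.le
    have h5 : (8 : ℝ) / a = 2 * (4 / a) := by ring
    nlinarith [mul_nonneg h4 (by linarith : 0 ≤ B + 8 * A)]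
  have h6 : 8 * b * (5 * a - 1) ≤ 8 * B / A * (5 * A - 1) * (1 + A ^ 2) := by
    have h7 : 8 * b ≤ 8 * B / A := by
      rw [le_div_iff₀ hA0]
      nlinarith
    have h8 : 8 * b * (5 * a - 1) ≤ 8 * B / A * (5 * A - 1) := by
      have : 0 ≤ 5 * a - 1 := by linarith
      gcongr
    have h9 : 0 ≤ 8 * b * (5 * a - 1) := mul_nonneg (by linarith) (by linarith)
    nlinarith [sq_nonneg A]
  have h10 : 16 * M / a ^ 2 = 4 * M / a ^ 2 * 4 := by ring
  have h11 : -(16 * M / a ^ 2 + 8 / a) ≤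
      -(4 * B / A ^ 2 * (1 + 3 * A ^ 2)) + 4 * (1 - A) / A * (B - 2 + 8 * A) := by linarith
  have h12 := mul_le_mul_of_nonneg_right h11 hP
  linarith

lemma hasDerivAt_gammaExpr {A B : ℝ → ℝ} {s a' b' : ℝ} (hA : HasDerivAt A a' s)
    (hB : HasDerivAt B b' s) :
    HasDerivAt (fun s => gammaExpr (A s) (B s))
      (b' * (1 + A s) + a' * (B s - 2 + 8 * A s)) s := by
  have h := (hB.mul (hA.const_add 1)).sub
    ((hA.const_mul 2).mul ((hA.const_mul 2).const_sub 1))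
  exact h.congr_deriv (by ring)

section Flow

variable {A B : ℝ → ℝ}

/-- The region above the curve `γ_A` with `A > 1/5` is preserved, with a uniform bound. -/
lemma exists_pos_le_gammaExpr (hAdiff : Differentiable ℝ A) (hBdiff : Differentiable ℝ B)
    (hApos : ∀ s : ℝ, 0 ≤ s → 0 < A s) (hBpos : ∀ s : ℝ, 0 ≤ s → 0 < B s)
    (hA : ∀ s : ℝ, 0 ≤ s → deriv A s = ricciW1 (A s) (B s))
    (hB : ∀ s : ℝ, 0 ≤ s → deriv B s = ricciW2 (A s) (B s))
    (hA0 : 1 / 5 < A 0) (hgamma : 0 < gammaExpr (A 0) (B 0)) :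
    ∃ p > 0, ∀ t, 0 ≤ t → p ≤ gammaExpr (A t) (B t) := by
  have hPdiff : Differentiable ℝ (fun s => gammaExpr (A s) (B s)) := fun s =>
    (hasDerivAt_gammaExpr (hAdiff s).hasDerivAt (hBdiff s).hasDerivAt).differentiableAt
  rcases le_total 1 (A 0) with h1 | h1
  · refine ⟨2, two_pos, fun t ht =>
      forall_ge_of_forall_pos_before hPdiff.continuous two_pos (fun t ht hpos => ?_) ht⟩
    have hAt : 1 ≤ A t := le_of_deriv_nonneg_below hAdiff ht h1 fun s hs hlt => by
      rw [hA s hs.1.le]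
      exact ricciW1_nonneg (hApos s hs.1.le) hlt.le (hpos s ⟨hs.1.le, hs.2⟩).le
    have hBt := hBpos t ht
    unfold gammaExpr
    nlinarith [mul_pos hBt (by linarith : 0 < 1 + A t)]
  · set a := A 0 with ha
    have ha0 : 0 < a := by linarith
    set b := min (B 0) (a ^ 2)
    set M := max (B 0) 6
    have hb : 0 < b := lt_min (hBpos 0 le_rfl) (by positivity)
    have hM : 0 < M := lt_max_of_lt_right (by norm_num)
    have hK : 0 < 16 * M / a ^ 2 + 8 / a := by positivity
    set K := 16 * M / a ^ 2 + 8 / a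
    have hE : 0 < 8 * b * (5 * a - 1) := mul_pos (by linarith) (by linarith)
    set p := min (gammaExpr (A 0) (B 0)) (8 * b * (5 * a - 1) / K)
    have hp : 0 < p := lt_min hgamma (div_pos hE hK)
    refine ⟨p, hp, fun t ht =>
      forall_ge_of_forall_pos_before hPdiff.continuous hp (fun t ht hpos => ?_) ht⟩
    have hAlow : ∀ s ∈ Icc 0 t, a ≤ A s := fun s hs =>
      le_of_deriv_nonneg_below hAdiff hs.1 le_rfl fun r hr hlt => by
        rw [hA r hr.1.le]
        exact ricciW1_nonneg (hApos r hr.1.le) (by linarith)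
          (hpos r ⟨hr.1.le, hr.2.trans_le hs.2⟩).le
    have hAup : ∀ s ∈ Icc 0 t, A s ≤ 1 := fun s hs =>
      le_of_deriv_nonpos_above hAdiff hs.1 h1 fun r hr hlt => by
        rw [hA r hr.1.le]
        exact ricciW1_nonpos hlt.le (hpos r ⟨hr.1.le, hr.2.trans_le hs.2⟩).le
    have hBlow : ∀ s ∈ Icc 0 t, b ≤ B s := fun s hs =>
      le_of_deriv_nonneg_below hBdiff hs.1 (min_le_left _ _) fun r hr hlt => by
        rw [hB r hr.1.le]
        refine ricciW2_nonneg (hBpos r hr.1.le) ?_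
        have hrI : r ∈ Icc 0 t := ⟨hr.1.le, hr.2.le.trans hs.2⟩
        have hlo := hAlow r hrI
        have hup := hAup r hrI
        have hBr : B r < a ^ 2 := hlt.trans_le (min_le_right _ _)
        have hsq : a ^ 2 ≤ A r ^ 2 := by gcongr
        have hsq1 : A r ^ 2 ≤ 1 := by nlinarith
        nlinarith [mul_nonneg (sq_nonneg (A r)) (by linarith : 0 ≤ 1 - A r),
          mul_nonneg (hBpos r hr.1.le).le (by linarith : 0 ≤ 1 - A r ^ 2)]
    have hBup : ∀ s ∈ Icc 0 t, B s ≤ M := fun s hs =>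
      le_of_deriv_nonpos_above hBdiff hs.1 (le_max_left _ _) fun r hr hlt => by
        rw [hB r hr.1.le]
        refine ricciW2_nonpos (hBpos r hr.1.le) ?_
        have hrI : r ∈ Icc 0 t := ⟨hr.1.le, hr.2.le.trans hs.2⟩
        have hup := hAup r hrI
        have hAr := hApos r hr.1.le
        have hBr : 6 < B r := (le_max_right _ _).trans_lt hlt
        nlinarith [mul_pos (sq_pos_of_pos hAr) hAr,
          mul_nonneg (sq_nonneg (A r)) (by linarith : 0 ≤ B r - 6)]
    refine le_of_deriv_nonneg_below hPdiff ht (min_le_left _ _) fun s hs hlt => ?_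
    have hsI : s ∈ Icc 0 t := ⟨hs.1.le, hs.2.le⟩
    rw [(hasDerivAt_gammaExpr (hAdiff s).hasDerivAt (hBdiff s).hasDerivAt).deriv,
      hA s hs.1.le, hB s hs.1.le]
    have hlow := gammaExpr_deriv_lower_bound hA0 (hAlow s hsI) (hAup s hsI) hb (hBlow s hsI)
      (hBup s hsI) (hpos s ⟨hs.1.le, hs.2⟩).le
    have hlt' : gammaExpr (A s) (B s) < 8 * b * (5 * a - 1) / K :=
      lt_of_lt_of_le hlt (min_le_right _ _)
    rw [lt_div_iff₀ hK] at hlt'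
    linarith

/-- If `gammaExpr` is bounded below by a positive constant along the flow, then `A` tends to `1`. -/
lemma tendsto_one_of_le_gammaExpr (hAdiff : Differentiable ℝ A)
    (hApos : ∀ s : ℝ, 0 ≤ s → 0 < A s)
    (hA : ∀ s : ℝ, 0 ≤ s → deriv A s = ricciW1 (A s) (B s))
    {p : ℝ} (hp : 0 < p) (hP : ∀ t, 0 ≤ t → p ≤ gammaExpr (A t) (B t)) :
    Tendsto A atTop (𝓝 1) := by
  set M := max (A 0) 1
  have hM : 0 < M := lt_max_of_lt_right one_pos
  have hAM : ∀ s, 0 ≤ s → A s ≤ M := fun s hs =>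
    le_of_deriv_nonpos_above hAdiff hs (le_max_left _ _) fun r hr hlt => by
      rw [hA r hr.1.le]
      exact ricciW1_nonpos ((le_max_right _ _).trans hlt.le) (hp.le.trans (hP r hr.1.le))
  have hup : ∀ ε > 0, ∀ᶠ s in atTop, A s ≤ 1 + ε := fun ε hε => by
    refine eventually_le_of_deriv_le_above hAdiff (c := 4 * ε / M * p) (by positivity) ?_
    filter_upwards [eventually_ge_atTop 0] with s hs hlt
    have hAs := hApos s hs
    have h1 : 4 * ε / M ≤ 4 * (A s - 1) / A s := by
      have := hAM s hs
      have : ε ≤ A s - 1 := by linarith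
      gcongr
      linarith
    have h2 : 4 * ε / M * p ≤ 4 * (A s - 1) / A s * gammaExpr (A s) (B s) := by
      have := hP s hs
      have : 0 < 4 * ε / M := by positivity
      gcongr
      linarith
    have h3 : ricciW1 (A s) (B s) = -(4 * (A s - 1) / A s * gammaExpr (A s) (B s)) := by
      unfold ricciW1 gammaExpr
      ring
    rw [hA s hs, h3]
    linarith
  have hlow : ∀ ε > 0, ∀ᶠ s in atTop, 1 - ε ≤ A s := fun ε hε => by
    refine eventually_ge_of_le_deriv_below hAdiff (c := 4 * ε / M * p) (by positivity) ?_
    filter_upwards [eventually_ge_atTop 0] with s hs hlt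
    have hAs := hApos s hs
    have h1 : 4 * ε / M ≤ 4 * (1 - A s) / A s := by
      have := hAM s hs
      have : ε ≤ 1 - A s := by linarith
      gcongr
      linarith
    rw [hA s hs]
    have := hP s hs
    have h0 : 0 < 4 * ε / M := by positivity
    exact mul_le_mul h1 this hp.le (h0.le.trans h1)
  refine tendsto_order.2 ⟨fun l hl => ?_, fun u hu => ?_⟩
  · filter_upwards [hlow ((1 - l) / 2) (by linarith)] with s hs
    linarith
  · filter_upwards [hup ((u - 1) / 2) (by linarith)] with s hs
    linarith

/-- If `A` tends to `1` along the flow, then so does `B`. -/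
lemma tendsto_one_of_tendsto_one (hBdiff : Differentiable ℝ B)
    (hApos : ∀ s : ℝ, 0 ≤ s → 0 < A s) (hBpos : ∀ s : ℝ, 0 ≤ s → 0 < B s)
    (hB : ∀ s : ℝ, 0 ≤ s → deriv B s = ricciW2 (A s) (B s))
    (hlim : Tendsto A atTop (𝓝 1)) : Tendsto B atTop (𝓝 1) := by
  have hQ : ∀ β : ℝ, Tendsto (fun s => 2 * A s ^ 2 * (3 - A s) - β * (1 + 3 * A s ^ 2)) atTop
      (𝓝 (4 - 4 * β)) := fun β => by
    have hc : Continuous fun x : ℝ => 2 * x ^ 2 * (3 - x) - β * (1 + 3 * x ^ 2) := by fun_prop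
    have h := (hc.tendsto 1).comp hlim
    have hval : 2 * (1 : ℝ) ^ 2 * (3 - 1) - β * (1 + 3 * 1 ^ 2) = 4 - 4 * β := by ring
    rwa [hval] at h
  have hA2 : ∀ᶠ s in atTop, A s ≤ 2 := (hlim.eventually_lt_const one_lt_two).mono fun _ => le_of_lt
  have hcoef : ∀ {x y β : ℝ}, 0 < x → x ≤ 2 → 0 ≤ β → β ≤ y → β ≤ 4 * y / x ^ 2 := by
    intro x y β hx hx2 hβ hy
    rw [le_div_iff₀ (by positivity)]
    have : x ^ 2 ≤ 4 := by nlinarith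
    nlinarith
  have hup : ∀ ε > 0, ∀ᶠ s in atTop, B s ≤ 1 + ε := fun ε hε => by
    refine eventually_le_of_deriv_le_above hBdiff (c := ε) hε ?_
    filter_upwards [eventually_ge_atTop 0, hA2,
      (hQ (1 + ε)).eventually_lt_const (by linarith : 4 - 4 * (1 + ε) < -ε)] with s hs h2 hq hlt
    have h1 : 1 ≤ 4 * B s / A s ^ 2 :=
      hcoef (hApos s hs) h2 zero_le_one (by linarith)
    have h3 : 2 * A s ^ 2 * (3 - A s) - B s * (1 + 3 * A s ^ 2) ≤ -ε := by
      nlinarith [mul_pos (sub_pos.2 hlt) (by positivity : 0 < 1 + 3 * A s ^ 2)]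
    rw [hB s hs]
    unfold ricciW2
    nlinarith
  have hbelow : ∃ b > 0, ∀ᶠ s in atTop, b ≤ B s := by
    obtain ⟨T, hT⟩ := eventually_atTop.1
      ((eventually_ge_atTop 0).and
        ((hQ (1 / 2)).eventually_const_lt (by norm_num : 0 < 4 - 4 * (1 / 2 : ℝ))))
    have hT0 := (hT T le_rfl).1
    refine ⟨min (B T) (1 / 2), lt_min (hBpos T hT0) (by norm_num), ?_⟩
    filter_upwards [eventually_ge_atTop T] with s hs
    refine le_of_deriv_nonneg_below hBdiff hs (min_le_left _ _) fun r hr hlt => ?_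
    obtain ⟨hr0, hq⟩ := hT r hr.1.le
    rw [hB r hr0]
    refine ricciW2_nonneg (hBpos r hr0) ?_
    have : B r < 1 / 2 := hlt.trans_le (min_le_right _ _)
    nlinarith [mul_pos (sub_pos.2 this) (by positivity : 0 < 1 + 3 * A r ^ 2)]
  obtain ⟨b, hb, hbB⟩ := hbelow
  have hlow : ∀ ε > 0, ∀ᶠ s in atTop, 1 - ε ≤ B s := fun ε hε => by
    refine eventually_ge_of_le_deriv_below hBdiff (c := b * ε) (by positivity) ?_
    filter_upwards [eventually_ge_atTop 0, hA2, hbB,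
      (hQ (1 - ε)).eventually_const_lt (by linarith : ε < 4 - 4 * (1 - ε))] with s hs h2 hbs hq hlt
    have h1 : b ≤ 4 * B s / A s ^ 2 := hcoef (hApos s hs) h2 hb.le hbs
    have h3 : ε ≤ 2 * A s ^ 2 * (3 - A s) - B s * (1 + 3 * A s ^ 2) := by
      nlinarith [mul_pos (sub_pos.2 hlt) (by positivity : 0 < 1 + 3 * A s ^ 2)]
    rw [hB s hs]
    exact mul_le_mul h1 h3 hε.le (hb.le.trans h1)
  refine tendsto_order.2 ⟨fun l hl => ?_, fun u hu => ?_⟩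
  · filter_upwards [hlow ((1 - l) / 2) (by linarith)] with s hs
    linarith
  · filter_upwards [hup ((u - 1) / 2) (by linarith)] with s hs
    linarith

end Flow

theorem ricci_convergence_to_sasakian (A B : ℝ → ℝ)
    (hAdiff : Differentiable ℝ A) (hBdiff : Differentiable ℝ B)
    (hApos : ∀ s : ℝ, 0 ≤ s → 0 < A s) (hBpos : ∀ s : ℝ, 0 ≤ s → 0 < B s)
    (hA : ∀ s : ℝ, 0 ≤ s → deriv A s = ricciW1 (A s) (B s))
    (hB : ∀ s : ℝ, 0 ≤ s → deriv B s = ricciW2 (A s) (B s))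
    (hA0 : 1 / 5 < A 0)
    (hgamma : B 0 * (1 + A 0) > 2 * A 0 * (1 - 2 * A 0)) :
    Filter.Tendsto (fun s => (A s, B s)) Filter.atTop (nhds ((1 : ℝ), (1 : ℝ))) := by
  obtain ⟨p, hp, hP⟩ := exists_pos_le_gammaExpr hAdiff hBdiff hApos hBpos hA hB hA0
    (sub_pos.2 hgamma)
  have hlimA := tendsto_one_of_le_gammaExpr hAdiff hApos hA hp hP
  exact hlimA.prodMk_nhds (tendsto_one_of_tendsto_one hBdiff hApos hBpos hB hlimA)
end
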